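/- arXiv:1603.03056 — 8 statements merged into one kernel-verified Lean document; each statement's English description precedes it below -/
import Mathlib

section
/- Let n ∈ ℕ and v > 0, and set x := 4πnv. For real s > 1 define M(s) := x^s e^{x/2} · (Γ(2s)/(Γ(s+1)Γ(s−1))) · ∫_0^1 t^s (1−t)^{s−2} e^{−xt} dt and W(s) := x^s e^{x/2} · (1/Γ(s−1)) · ∫_1^∞ t^s (t−1)^{s−2} e^{−xt} dt (these are the Whittaker functions M_{1,s−1/2}(x) and W_{1,s−1/2}(x)). Then the one-sided limit 𝔐 := lim_{s→1⁺} (M(s) − W(s))/(s−1) exists, and e^{2πnv} · ( 𝔐/(4πv) − (1−γ) n e^{−2πnv} ) = −n e^{4πnv}/(4πnv) + n ( Σ_{j=1}^∞ (4πnv)^j/(j!·j) + log(4πnv) + γ ). Equivalently, the function 𝓜_n(v) := 𝔐/(4πv) − (1−γ) n e^{−2πnv} satisfies e^{2πnv} 𝓜_n(v) = n·W₂(2πnv), where W₂(x) = −e^{2x}/(2x) + Σ_{j≥1}(2x)^j/(j!·j) + log(2x) + γ is the real value of the analytically continued weight-2 special function. -/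
open MeasureTheory Set Filter Topology

section WhittakerAux

variable {x s u : ℝ}

lemma exp_mul_sub_one_le (hx : 0 ≤ x) (hu : u ∈ Icc (0 : ℝ) 1) :
    Real.exp (x * u) - 1 ≤ x * Real.exp x * u := by
  have hxu : 0 ≤ x * u := mul_nonneg hx hu.1
  have h1 := Real.add_one_le_exp (-(x * u))
  have h2 : Real.exp (x * u) * Real.exp (-(x * u)) = 1 := by rw [← Real.exp_add]; simp
  have h3 : Real.exp (x * u) ≤ Real.exp x := Real.exp_le_exp.2 (mul_le_of_le_one_right hx hu.2)
  nlinarith [mul_le_mul_of_nonneg_left h1 (Real.exp_pos (x * u)).le,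
    mul_le_mul_of_nonneg_left h3 hxu]

lemma abs_one_sub_rpow_mul_exp_sub_one_mul_rpow_le (hx : 0 < x) (hs : s ∈ Ioo (1 : ℝ) 2)
    (hu : u ∈ Ioc (0 : ℝ) 1) :
    |((1 - u) ^ s * Real.exp (x * u) - 1) * u ^ (s - 2)| ≤ x * Real.exp x + 2 := by
  obtain ⟨hs1, hs2⟩ := hs
  obtain ⟨hu0, hu1⟩ := hu
  have hq1 : (1 - u) ^ s ≤ 1 := Real.rpow_le_one (by linarith) (by linarith) (by linarith)
  have hq0 : 0 ≤ (1 - u) ^ s := Real.rpow_nonneg (by linarith) _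
  have hq2 : (1 - u) ^ 2 ≤ (1 - u) ^ s := by
    rw [← Real.rpow_natCast (1 - u) 2]
    exact Real.rpow_le_rpow_of_exponent_ge_of_imp (by linarith) (by linarith)
      (by push_cast; linarith) (fun _ h => by norm_num at h)
  have hE1 : 1 ≤ Real.exp (x * u) := Real.one_le_exp (by positivity)
  have hE2 := exp_mul_sub_one_le hx.le ⟨hu0.le, hu1⟩
  have hmain : |(1 - u) ^ s * Real.exp (x * u) - 1| ≤ u * (x * Real.exp x + 2) := by
    have : 0 < u * (x * Real.exp x) := by positivity
    rw [abs_le]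
    constructor <;> nlinarith
  have hsplit : u ^ (s - 2) = u ^ (s - 1) / u := by
    rw [← Real.rpow_sub_one hu0.ne']; ring_nf
  have hp1 : u ^ (s - 1) ≤ 1 := Real.rpow_le_one hu0.le hu1 (by linarith)
  have hp0 : 0 ≤ u ^ (s - 1) := Real.rpow_nonneg hu0.le _
  rw [abs_mul, hsplit, abs_of_nonneg (by positivity : 0 ≤ u ^ (s - 1) / u), mul_div_assoc',
    div_le_iff₀ hu0]
  calc _ ≤ u * (x * Real.exp x + 2) * 1 := by gcongr
    _ = _ := by ring

lemma abs_one_add_rpow_sub_one_mul_exp_mul_rpow_le (hs : s ∈ Ioo (1 : ℝ) 2)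
    (hu : 0 < u) :
    |((1 + u) ^ s - 1) * Real.exp (-x * u) * u ^ (s - 2)|
      ≤ (2 + 3 * u + u ^ 2) * Real.exp (-x * u) := by
  obtain ⟨hs1, hs2⟩ := hs
  have hq1 : 1 ≤ (1 + u) ^ s := Real.one_le_rpow (by linarith) (by linarith)
  have hq2 : (1 + u) ^ s ≤ (1 + u) ^ 2 := by
    rw [← Real.rpow_natCast (1 + u) 2]
    exact Real.rpow_le_rpow_of_exponent_le (by linarith) (by push_cast; linarith)
  have hsplit : u ^ (s - 2) = u ^ (s - 1) / u := by
    rw [← Real.rpow_sub_one hu.ne']; ring_nf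
  have hp0 : 0 ≤ u ^ (s - 1) := Real.rpow_nonneg hu.le _
  have hp1 : u ^ (s - 1) ≤ 1 + u :=
    calc u ^ (s - 1) ≤ (1 + u) ^ (s - 1) := Real.rpow_le_rpow hu.le (by linarith) (by linarith)
      _ ≤ (1 + u) ^ (1 : ℝ) := Real.rpow_le_rpow_of_exponent_le (by linarith) (by linarith)
      _ = 1 + u := Real.rpow_one _
  have h0 : 0 ≤ (1 + u) ^ s - 1 := by linarith
  have h1 : 0 ≤ (1 + u) ^ 2 - 1 := by nlinarith
  rw [abs_of_nonneg (by positivity), mul_right_comm]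
  gcongr
  rw [hsplit, mul_div_assoc', div_le_iff₀ hu]
  calc _ ≤ ((1 + u) ^ 2 - 1) * (1 + u) := by gcongr
    _ = _ := by ring

lemma integrableOn_quadratic_mul_exp_neg_mul (hx : 0 < x) :
    IntegrableOn (fun u : ℝ => (2 + 3 * u + u ^ 2) * Real.exp (-x * u)) (Ioi 0) := by
  have h (k : ℕ) : IntegrableOn (fun u : ℝ => u ^ k * Real.exp (-x * u)) (Ioi 0) := by
    simpa using integrableOn_rpow_mul_exp_neg_mul_rpow (p := 1) (s := k) (b := x)
      (lt_of_lt_of_le (by norm_num) k.cast_nonneg) one_pos hx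
  refine ((((h 0).const_mul 2).add ((h 1).const_mul 3)).add (h 2)).congr ?_
  filter_upwards with u
  simp only [Pi.add_apply]
  ring

lemma intervalIntegrable_one_sub_rpow_mul_exp_sub_one_mul_rpow (hx : 0 < x)
    (hs : s ∈ Ioo (1 : ℝ) 2) :
    IntervalIntegrable (fun u : ℝ => ((1 - u) ^ s * Real.exp (x * u) - 1) * u ^ (s - 2))
      volume 0 1 := by
  rw [intervalIntegrable_iff_integrableOn_Ioc_of_le zero_le_one]
  refine Integrable.mono' (integrable_const (x * Real.exp x + 2))
    (by fun_prop) ?_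
  filter_upwards [ae_restrict_mem measurableSet_Ioc] with u hu
  exact abs_one_sub_rpow_mul_exp_sub_one_mul_rpow_le hx hs hu

lemma integrableOn_one_add_rpow_sub_one_mul_exp_mul_rpow (hx : 0 < x)
    (hs : s ∈ Ioo (1 : ℝ) 2) :
    IntegrableOn (fun u : ℝ => ((1 + u) ^ s - 1) * Real.exp (-x * u) * u ^ (s - 2))
      (Ioi 0) := by
  refine Integrable.mono' (integrableOn_quadratic_mul_exp_neg_mul hx) (by fun_prop) ?_
  filter_upwards [ae_restrict_mem measurableSet_Ioi] with u hu
  exact abs_one_add_rpow_sub_one_mul_exp_mul_rpow_le hs hu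

lemma tendsto_integral_one_sub_rpow_mul_exp_sub_one_mul_rpow (hx : 0 < x) :
    Tendsto (fun s : ℝ => ∫ u in (0 : ℝ)..1, ((1 - u) ^ s * Real.exp (x * u) - 1) * u ^ (s - 2))
      (𝓝[>] 1) (𝓝 (∫ u in (0 : ℝ)..1, ((1 - u) * Real.exp (x * u) - 1) / u)) := by
  refine intervalIntegral.tendsto_integral_filter_of_dominated_convergence
    (fun _ => x * Real.exp x + 2) (.of_forall fun s => by fun_prop) ?_ (by simp) ?_
  · filter_upwards [Ioo_mem_nhdsGT (one_lt_two : (1 : ℝ) < 2)] with s hs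
    refine .of_forall fun u hu => ?_
    rw [uIoc_of_le zero_le_one] at hu
    exact abs_one_sub_rpow_mul_exp_sub_one_mul_rpow_le hx hs hu
  · refine .of_forall fun u hu => ?_
    rw [uIoc_of_le zero_le_one] at hu
    have h1 : ContinuousAt (fun s : ℝ => (1 - u) ^ s) 1 :=
      Real.continuousAt_const_rpow' one_ne_zero
    have h2 : ContinuousAt (fun s : ℝ => u ^ (s - 2)) 1 :=
      (Real.continuousAt_const_rpow hu.1.ne').comp (f := fun s : ℝ => s - 2) (by fun_prop)
    have h := ((h1.mul_const (Real.exp (x * u))).sub_const 1).mul h2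
    have h3 : (1 : ℝ) - 2 = -1 := by norm_num
    simpa [ContinuousAt, h3, Real.rpow_neg_one, div_eq_mul_inv] using
      Tendsto.mono_left h nhdsWithin_le_nhds

lemma tendsto_integral_one_add_rpow_sub_one_mul_exp_mul_rpow (hx : 0 < x) :
    Tendsto (fun s : ℝ => ∫ u in Ioi (0 : ℝ), ((1 + u) ^ s - 1) * Real.exp (-x * u) * u ^ (s - 2))
      (𝓝[>] 1) (𝓝 (1 / x)) := by
  have hval : ∫ u in Ioi (0 : ℝ), Real.exp (-x * u) = 1 / x := by
    rw [integral_exp_mul_Ioi (neg_lt_zero.2 hx)]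
    simp
  rw [← hval]
  refine tendsto_integral_filter_of_dominated_convergence
    (fun u => (2 + 3 * u + u ^ 2) * Real.exp (-x * u)) (.of_forall fun s => by fun_prop) ?_
    (integrableOn_quadratic_mul_exp_neg_mul hx) ?_
  · filter_upwards [Ioo_mem_nhdsGT (one_lt_two : (1 : ℝ) < 2)] with s hs
    filter_upwards [ae_restrict_mem measurableSet_Ioi] with u hu
    exact abs_one_add_rpow_sub_one_mul_exp_mul_rpow_le hs hu
  · filter_upwards [ae_restrict_mem measurableSet_Ioi] with u hu
    have hu : 0 < u := hu
    have h1 : ContinuousAt (fun s : ℝ => (1 + u) ^ s) 1 :=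
      Real.continuousAt_const_rpow (by positivity)
    have h2 : ContinuousAt (fun s : ℝ => u ^ (s - 2)) 1 :=
      (Real.continuousAt_const_rpow hu.ne').comp (f := fun s : ℝ => s - 2) (by fun_prop)
    have h := ((h1.sub_const 1).mul_const (Real.exp (-x * u))).mul h2
    have h3 : (1 : ℝ) - 2 = -1 := by norm_num
    have h4 : Real.exp (-x * u) = ((1 + u) ^ (1 : ℝ) - 1) * Real.exp (-x * u) * u ^ ((1 : ℝ) - 2) := by
      rw [h3, Real.rpow_neg_one, Real.rpow_one]
      field_simp
      ring
    exact (Tendsto.mono_left h nhdsWithin_le_nhds).trans_eq (congrArg 𝓝 h4.symm)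

lemma hasSum_integral_exp_sub_one_div (x : ℝ) :
    HasSum (fun j : ℕ => x ^ (j + 1) / (((j + 1).factorial : ℝ) * (j + 1)))
      (∫ u in (0 : ℝ)..1, (Real.exp (x * u) - 1) / u) := by
  let f (j : ℕ) : C(ℝ, ℝ) := ⟨fun u => x ^ (j + 1) / ((j + 1).factorial : ℝ) * u ^ j, by fun_prop⟩
  have hsum : Summable fun j => ‖(f j).restrict (⟨uIcc (0 : ℝ) 1, isCompact_uIcc⟩ :
      TopologicalSpace.Compacts ℝ)‖ := by
    have hs : Summable fun j : ℕ => |x| ^ (j + 1) / ((j + 1).factorial : ℝ) :=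
      (summable_nat_add_iff 1).2 (Real.summable_pow_div_factorial |x|)
    refine hs.of_nonneg_of_le (fun _ => norm_nonneg _) fun j => ?_
    rw [ContinuousMap.norm_le _ (by positivity)]
    rintro ⟨u, hu⟩
    have hu' : u ∈ Icc (0 : ℝ) 1 := by simpa [uIcc_of_le] using hu
    have : |u| ^ j ≤ 1 := pow_le_one₀ (abs_nonneg u) (abs_le.2 ⟨by linarith [hu'.1], hu'.2⟩)
    have h0 : 0 ≤ |x| ^ (j + 1) / ((j + 1).factorial : ℝ) := by positivity
    simpa [f, abs_mul, abs_div] using mul_le_of_le_one_right h0 this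
  have h := intervalIntegral.hasSum_intervalIntegral_of_summable_norm hsum
  have hint (j : ℕ) : ∫ u in (0 : ℝ)..1, f j u
      = x ^ (j + 1) / (((j + 1).factorial : ℝ) * (j + 1)) := by
    simp only [f, ContinuousMap.coe_mk, intervalIntegral.integral_const_mul, integral_pow]
    field_simp
    simp
  simp only [hint] at h
  refine (congrArg (HasSum _) ?_).mpr h
  refine intervalIntegral.integral_congr_ae (.of_forall fun u hu => ?_)
  rw [uIoc_of_le zero_le_one] at hu
  have hexp := NormedSpace.expSeries_div_hasSum_exp (𝔸 := ℝ) (x * u)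
  rw [← Real.exp_eq_exp_ℝ, ← hasSum_nat_add_iff' 1] at hexp
  have := hexp.div_const u
  simp only [Finset.range_one, Finset.sum_singleton, pow_zero, Nat.factorial_zero, Nat.cast_one,
    div_one] at this
  rw [← this.tsum_eq]
  refine tsum_congr fun j => ?_
  have := hu.1.ne'
  simp only [f, ContinuousMap.coe_mk]
  field_simp
  ring

lemma integral_one_sub_mul_exp_sub_one_div (hx : 0 < x) :
    ∫ u in (0 : ℝ)..1, ((1 - u) * Real.exp (x * u) - 1) / u
      = (∑' j : ℕ, x ^ (j + 1) / (((j + 1).factorial : ℝ) * (j + 1))) - (Real.exp x - 1) / x := by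
  have hE : ∫ u in (0 : ℝ)..1, Real.exp (x * u) = (Real.exp x - 1) / x := by
    rw [intervalIntegral.integral_comp_mul_left _ hx.ne', integral_exp]
    simp
    ring
  have hbound : IntervalIntegrable (fun u : ℝ => (Real.exp (x * u) - 1) / u) volume 0 1 := by
    rw [intervalIntegrable_iff_integrableOn_Ioc_of_le zero_le_one]
    refine Integrable.mono' (integrable_const (x * Real.exp x)) ?_ ?_
    · exact (by fun_prop : Measurable fun u : ℝ => (Real.exp (x * u) - 1) / u).aestronglyMeasurable
    filter_upwards [ae_restrict_mem measurableSet_Ioc] with u hu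
    have hu0 := hu.1
    have hE1 : 1 ≤ Real.exp (x * u) := Real.one_le_exp (by positivity)
    rw [Real.norm_of_nonneg (div_nonneg (by linarith) hu0.le), div_le_iff₀ hu0]
    exact exp_mul_sub_one_le hx.le ⟨hu0.le, hu.2⟩
  rw [(hasSum_integral_exp_sub_one_div x).tsum_eq, ← hE, ← intervalIntegral.integral_sub hbound
    (by apply Continuous.intervalIntegrable; fun_prop)]
  refine intervalIntegral.integral_congr_ae (.of_forall fun u hu => ?_)
  rw [uIoc_of_le zero_le_one] at hu
  have := hu.1.ne'
  field_simp
  ring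

lemma integral_rpow_mul_one_sub_rpow_mul_exp_eq (hx : 0 < x) (hs : s ∈ Ioo (1 : ℝ) 2) :
    ∫ t in (0 : ℝ)..1, t ^ s * (1 - t) ^ (s - 2) * Real.exp (-x * t)
      = Real.exp (-x) * (1 / (s - 1)
        + ∫ u in (0 : ℝ)..1, ((1 - u) ^ s * Real.exp (x * u) - 1) * u ^ (s - 2)) := by
  have hpow : ∫ u in (0 : ℝ)..1, u ^ (s - 2) = 1 / (s - 1) := by
    rw [integral_rpow (Or.inl (by linarith [hs.1])), Real.one_rpow,
      Real.zero_rpow (by linarith [hs.1])]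
    ring_nf
  have hi : IntervalIntegrable (fun u : ℝ => u ^ (s - 2)) volume 0 1 :=
    intervalIntegral.intervalIntegrable_rpow' (by linarith [hs.1])
  have hsub := intervalIntegral.integral_comp_sub_left (a := 0) (b := 1)
    (fun t : ℝ => t ^ s * (1 - t) ^ (s - 2) * Real.exp (-x * t)) 1
  rw [sub_self, sub_zero] at hsub
  rw [← hsub, ← hpow, ← intervalIntegral.integral_add hi
    (intervalIntegrable_one_sub_rpow_mul_exp_sub_one_mul_rpow hx hs),
    ← intervalIntegral.integral_const_mul]
  refine intervalIntegral.integral_congr fun u _ => ?_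
  have : Real.exp (-x * (1 - u)) = Real.exp (-x) * Real.exp (x * u) := by
    rw [← Real.exp_add]; ring_nf
  simp only [this, sub_sub_cancel]
  ring

lemma integral_Ioi_rpow_mul_sub_one_rpow_mul_exp_eq (hx : 0 < x) (hs : s ∈ Ioo (1 : ℝ) 2) :
    ∫ t in Ioi (1 : ℝ), t ^ s * (t - 1) ^ (s - 2) * Real.exp (-x * t)
      = Real.exp (-x) * (Real.Gamma s * x ^ (1 - s) / (s - 1)
        + ∫ u in Ioi (0 : ℝ), ((1 + u) ^ s - 1) * Real.exp (-x * u) * u ^ (s - 2)) := by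
  have hs1 : 0 < s - 1 := by linarith [hs.1]
  have hG : ∫ u in Ioi (0 : ℝ), u ^ (s - 2) * Real.exp (-x * u)
      = Real.Gamma s * x ^ (1 - s) / (s - 1) := by
    have h := Real.integral_rpow_mul_exp_neg_mul_Ioi hs1 hx
    have hΓ := Real.Gamma_add_one hs1.ne'
    rw [sub_add_cancel] at hΓ
    have e : s - 1 - 1 = s - 2 := by ring
    simp only [e, ← neg_mul] at h
    rw [h, hΓ, one_div, Real.inv_rpow hx.le, ← Real.rpow_neg hx.le, neg_sub]
    field_simp
  have hi : IntegrableOn (fun u : ℝ => u ^ (s - 2) * Real.exp (-x * u)) (Ioi 0) := by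
    simpa using integrableOn_rpow_mul_exp_neg_mul_rpow (p := 1) (s := s - 2) (b := x)
      (by linarith) one_pos hx
  have hsub := (measurePreserving_add_right volume (1 : ℝ)).setIntegral_preimage_emb
    (measurableEmbedding_addRight 1)
    (fun t : ℝ => t ^ s * (t - 1) ^ (s - 2) * Real.exp (-x * t)) (Ioi 1)
  rw [preimage_add_const_Ioi, sub_self] at hsub
  rw [← hsub, ← hG, ← integral_add hi
    (integrableOn_one_add_rpow_sub_one_mul_exp_mul_rpow hx hs), ← integral_const_mul]
  refine setIntegral_congr_fun measurableSet_Ioi fun u _ => ?_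
  have : Real.exp (-x * (u + 1)) = Real.exp (-x) * Real.exp (-x * u) := by
    rw [← Real.exp_add]; ring_nf
  simp only [add_sub_cancel_right]
  rw [this, add_comm u 1]
  ring

lemma hasDerivAt_Gamma_two_mul_div_Gamma_add_one :
    HasDerivAt (fun s : ℝ => Real.Gamma (2 * s) / Real.Gamma (s + 1))
      (1 - Real.eulerMascheroniConstant) 1 := by
  have h2 : HasDerivAt Real.Gamma (1 - Real.eulerMascheroniConstant) 2 := by
    convert Real.hasDerivAt_Gamma_nat 1 using 1
    · simp [harmonic]; ring
    · norm_num
  have ha : HasDerivAt (fun s : ℝ => Real.Gamma (2 * s))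
      ((1 - Real.eulerMascheroniConstant) * 2) 1 := by
    refine HasDerivAt.comp (h := fun s : ℝ => 2 * s) (1 : ℝ) (by simpa using h2) ?_
    simpa using (hasDerivAt_id (1 : ℝ)).const_mul 2
  have hb : HasDerivAt (fun s : ℝ => Real.Gamma (s + 1))
      (1 - Real.eulerMascheroniConstant) 1 :=
    HasDerivAt.comp_add_const 1 1 (by norm_num; exact h2)
  refine (ha.div hb (by norm_num)).congr_deriv ?_
  norm_num [Real.Gamma_two]
  ring

lemma hasDerivAt_Gamma_mul_rpow_one_sub (hx : 0 < x) :
    HasDerivAt (fun s : ℝ => Real.Gamma s * x ^ (1 - s))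
      (-Real.eulerMascheroniConstant - Real.log x) 1 := by
  have h := Real.hasDerivAt_Gamma_one.mul
    (((hasDerivAt_id (1 : ℝ)).const_sub 1).const_rpow hx)
  refine h.congr_deriv ?_
  simp
  ring

lemma whittaker_difference_quotient_eq (hx : 0 < x) (hs : s ∈ Ioo (1 : ℝ) 2) :
    (x ^ s * Real.exp (x / 2) * (Real.Gamma (2 * s) / (Real.Gamma (s + 1) * Real.Gamma (s - 1)))
        * (∫ t in (0 : ℝ)..1, t ^ s * (1 - t) ^ (s - 2) * Real.exp (-x * t))
      - x ^ s * Real.exp (x / 2) * (1 / Real.Gamma (s - 1))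
        * (∫ t in Ioi (1 : ℝ), t ^ s * (t - 1) ^ (s - 2) * Real.exp (-x * t))) / (s - 1)
    = x ^ s * Real.exp (-(x / 2)) / Real.Gamma s
      * ((Real.Gamma (2 * s) / Real.Gamma (s + 1) - Real.Gamma s * x ^ (1 - s)) / (s - 1)
        + Real.Gamma (2 * s) / Real.Gamma (s + 1)
          * (∫ u in (0 : ℝ)..1, ((1 - u) ^ s * Real.exp (x * u) - 1) * u ^ (s - 2))
        - ∫ u in Ioi (0 : ℝ), ((1 + u) ^ s - 1) * Real.exp (-x * u) * u ^ (s - 2)) := by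
  have hs1 : 0 < s - 1 := by linarith [hs.1]
  rw [integral_rpow_mul_one_sub_rpow_mul_exp_eq hx hs,
    integral_Ioi_rpow_mul_sub_one_rpow_mul_exp_eq hx hs]
  have hΓ := Real.Gamma_add_one hs1.ne'
  rw [sub_add_cancel] at hΓ
  have hE : Real.exp (-(x / 2)) = Real.exp (x / 2) * Real.exp (-x) := by
    rw [← Real.exp_add]; ring_nf
  have h1 : Real.Gamma (s - 1) ≠ 0 := (Real.Gamma_pos_of_pos hs1).ne'
  have h2 : Real.Gamma (s + 1) ≠ 0 := (Real.Gamma_pos_of_pos (by linarith)).ne'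
  rw [hE, hΓ]
  have := hs1.ne'
  field_simp
  ring

lemma tendsto_whittaker_difference_quotient (hx : 0 < x) :
    Tendsto (fun s : ℝ =>
      (x ^ s * Real.exp (x / 2)
          * (Real.Gamma (2 * s) / (Real.Gamma (s + 1) * Real.Gamma (s - 1)))
          * (∫ t in (0 : ℝ)..1, t ^ s * (1 - t) ^ (s - 2) * Real.exp (-x * t))
        - x ^ s * Real.exp (x / 2) * (1 / Real.Gamma (s - 1))
          * (∫ t in Ioi (1 : ℝ), t ^ s * (t - 1) ^ (s - 2) * Real.exp (-x * t))) / (s - 1))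
      (𝓝[>] 1)
      (𝓝 (x * Real.exp (-(x / 2)) * (1 + Real.log x
        + (∑' j : ℕ, x ^ (j + 1) / (((j + 1).factorial : ℝ) * (j + 1))) - Real.exp x / x))) := by
  have hA := hasDerivAt_Gamma_two_mul_div_Gamma_add_one
  have hB := hasDerivAt_Gamma_mul_rpow_one_sub hx
  have hslope : Tendsto (fun s : ℝ =>
      (Real.Gamma (2 * s) / Real.Gamma (s + 1) - Real.Gamma s * x ^ (1 - s)) / (s - 1))
      (𝓝[>] 1) (𝓝 (1 + Real.log x)) := by
    have h := (hasDerivWithinAt_iff_tendsto_slope' (self_notMem_Ioi)).1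
      ((hA.sub hB).hasDerivWithinAt (s := Ioi 1))
    refine (h.congr fun s => ?_).trans_eq ?_
    · norm_num [slope_def_field, Real.Gamma_two]
    · congr 1; ring
  have hA' : Tendsto (fun s : ℝ => Real.Gamma (2 * s) / Real.Gamma (s + 1)) (𝓝[>] 1) (𝓝 1) := by
    have h := hA.continuousAt.tendsto.mono_left (nhdsWithin_le_nhds (s := Ioi 1))
    norm_num [Real.Gamma_two] at h
    exact h
  have hpre : Tendsto (fun s : ℝ => x ^ s * Real.exp (-(x / 2)) / Real.Gamma s) (𝓝[>] 1)
      (𝓝 (x * Real.exp (-(x / 2)))) := by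
    have h : ContinuousAt (fun s : ℝ => x ^ s * Real.exp (-(x / 2)) / Real.Gamma s) 1 :=
      ((Real.continuousAt_const_rpow hx.ne').mul_const _).div
        Real.hasDerivAt_Gamma_one.continuousAt (by simp)
    simpa [ContinuousAt] using h.tendsto.mono_left (nhdsWithin_le_nhds (s := Ioi 1))
  have hR := tendsto_integral_one_sub_rpow_mul_exp_sub_one_mul_rpow hx
  rw [integral_one_sub_mul_exp_sub_one_div hx] at hR
  have h := hpre.mul ((hslope.add (hA'.mul hR)).sub
    (tendsto_integral_one_add_rpow_sub_one_mul_exp_mul_rpow hx))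
  convert h.congr' ?_ using 2
  · congr 1; ring
  · filter_upwards [Ioo_mem_nhdsGT (one_lt_two : (1 : ℝ) < 2)] with s hs
    exact (whittaker_difference_quotient_eq hx hs).symm

end WhittakerAux

/-- For `n ∈ ℕ`, `v > 0`, `x := 4πnv`: the one-sided limit
`𝔐 := lim_{s→1⁺} (M_{1,s−1/2}(x) − W_{1,s−1/2}(x))/(s−1)` exists and
`e^{2πnv}(𝔐/(4πv) − (1−γ)n e^{−2πnv}) = −n e^x/x + n(Σ_{j≥1} x^j/(j!·j) + log x + γ)`,
i.e. `e^{2πnv}·𝓜_n(v) = n·W₂(2πnv)`. -/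
theorem whittaker_difference_limit (n : ℕ) (hn : 0 < n) (v : ℝ) (hv : 0 < v) :
    ∃ 𝔐 : ℝ,
      Tendsto (fun s : ℝ =>
          ((4 * Real.pi * n * v) ^ s * Real.exp ((4 * Real.pi * n * v) / 2)
              * (Real.Gamma (2 * s) / (Real.Gamma (s + 1) * Real.Gamma (s - 1)))
              * (∫ t in (0:ℝ)..1,
                  t ^ s * (1 - t) ^ (s - 2) * Real.exp (-(4 * Real.pi * n * v) * t))
            - (4 * Real.pi * n * v) ^ s * Real.exp ((4 * Real.pi * n * v) / 2)
              * (1 / Real.Gamma (s - 1))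
              * (∫ t in Set.Ioi (1:ℝ),
                  t ^ s * (t - 1) ^ (s - 2) * Real.exp (-(4 * Real.pi * n * v) * t)))
          / (s - 1))
        (nhdsWithin 1 (Set.Ioi 1)) (nhds 𝔐) ∧
      Real.exp (2 * Real.pi * n * v)
          * (𝔐 / (4 * Real.pi * v)
            - (1 - Real.eulerMascheroniConstant) * n * Real.exp (-(2 * Real.pi * n * v)))
        = -n * Real.exp (4 * Real.pi * n * v) / (4 * Real.pi * n * v)
          + n * ((∑' j : ℕ,
                (4 * Real.pi * n * v) ^ (j + 1) / (((j + 1).factorial : ℝ) * (j + 1)))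
              + Real.log (4 * Real.pi * n * v) + Real.eulerMascheroniConstant) := by
  have hx : 0 < 4 * Real.pi * n * v := by positivity
  have hn' : (n : ℝ) ≠ 0 := by positivity
  refine ⟨_, tendsto_whittaker_difference_quotient hx, ?_⟩
  have hhalf : 4 * Real.pi * n * v / 2 = 2 * Real.pi * n * v := by ring
  have hE : Real.exp (-(2 * Real.pi * n * v)) = (Real.exp (2 * Real.pi * n * v))⁻¹ :=
    Real.exp_neg _
  rw [hhalf, hE]
  have hE0 := (Real.exp_pos (2 * Real.pi * n * v)).ne'
  have hpi := Real.pi_ne_zero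
  generalize Real.exp (2 * Real.pi * n * v) = E at *
  generalize (∑' j : ℕ, (4 * Real.pi * n * v) ^ (j + 1) / (((j + 1).factorial : ℝ) * (j + 1))) = S
  field_simp
  ring
end

section
/- For every real x > 0, the improper integral ∫_0^1 log(1−t)·(1−xt)·e^{−xt} dt converges and equals (e^{−x} − 1)/x + e^{−x} · Σ_{j=1}^∞ x^j/(j!·j). (Note (1−xt)e^{−xt} = d/dt (t e^{−xt}), and Σ_{j≥1} x^j/(j!·j) = −Ein(−x) where Ein is the complementary exponential integral.) -/
open MeasureTheory Set

/-- The slope `(e^{xs} - 1) / s` of `s ↦ e^{xs}` at the origin is continuous in `s`. -/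
lemma continuous_dslope_exp_mul (x : ℝ) :
    Continuous (dslope (fun s : ℝ => Real.exp (x * s)) 0) := by
  rw [← continuousOn_univ, continuousOn_dslope Filter.univ_mem]
  exact ⟨by fun_prop, by fun_prop⟩

lemma mul_dslope_exp_mul (x s : ℝ) :
    s * dslope (fun s : ℝ => Real.exp (x * s)) 0 s = Real.exp (x * s) - 1 := by
  simpa using sub_smul_dslope (fun s : ℝ => Real.exp (x * s)) 0 s

lemma hasSum_dslope_exp_mul (x : ℝ) {s : ℝ} (hs : s ≠ 0) :
    HasSum (fun j : ℕ => x ^ (j + 1) / ((j + 1).factorial : ℝ) * s ^ j)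
      (dslope (fun s : ℝ => Real.exp (x * s)) 0 s) := by
  have h : HasSum (fun j : ℕ => (x * s) ^ (j + 1) / ((j + 1).factorial : ℝ))
      (Real.exp (x * s) - 1) := by
    have hexp : HasSum (fun j : ℕ => (x * s) ^ j / (j.factorial : ℝ)) (Real.exp (x * s)) := by
      rw [Real.exp_eq_exp_ℝ]
      exact NormedSpace.expSeries_div_hasSum_exp (x * s)
    simpa using (hasSum_nat_add_iff' 1).2 hexp
  rw [← mul_dslope_exp_mul] at h
  have hmul := h.mul_left s⁻¹
  rw [inv_mul_cancel_left₀ hs] at hmul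
  have hterm (j : ℕ) : x ^ (j + 1) / ((j + 1).factorial : ℝ) * s ^ j
      = s⁻¹ * ((x * s) ^ (j + 1) / ((j + 1).factorial : ℝ)) := by
    rw [mul_pow]
    field_simp
    ring
  simpa only [hterm] using hmul

lemma integral_dslope_exp_mul (x : ℝ) :
    ∫ s in (0:ℝ)..1, dslope (fun s : ℝ => Real.exp (x * s)) 0 s
      = ∑' j : ℕ, x ^ (j + 1) / (((j + 1).factorial : ℝ) * (j + 1)) := by
  have hsum : Summable fun j : ℕ => |x| ^ (j + 1) / ((j + 1).factorial : ℝ) :=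
    (summable_nat_add_iff 1).2 (Real.summable_pow_div_factorial |x|)
  have h := intervalIntegral.hasSum_integral_of_dominated_convergence (a := 0) (b := 1)
    (μ := volume)
    (F := fun (j : ℕ) (s : ℝ) => x ^ (j + 1) / ((j + 1).factorial : ℝ) * s ^ j)
    (f := dslope (fun s : ℝ => Real.exp (x * s)) 0)
    (fun j _ => |x| ^ (j + 1) / ((j + 1).factorial : ℝ))
    (fun j => by fun_prop)
    (fun j => .of_forall fun s hs => by
      rw [uIoc_of_le zero_le_one] at hs
      rw [norm_mul, norm_div, norm_pow, norm_pow, Real.norm_natCast, Real.norm_eq_abs,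
        Real.norm_eq_abs, abs_of_pos hs.1]
      exact mul_le_of_le_one_right (by positivity) (pow_le_one₀ hs.1.le hs.2))
    (.of_forall fun _ _ => hsum) (by simp)
    (.of_forall fun s hs => hasSum_dslope_exp_mul x (by
      rw [uIoc_of_le zero_le_one] at hs
      exact hs.1.ne'))
  rw [← h.tsum_eq]
  refine tsum_congr fun j => ?_
  rw [intervalIntegral.integral_const_mul, integral_pow]
  simp
  field_simp

lemma integral_log_mul_exp (x : ℝ) (hx : x ≠ 0) :
    ∫ s in (0:ℝ)..1, Real.log s * ((1 - x + x * s) * Real.exp (x * s))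
      = (1 - Real.exp x) / x
        + ∑' j : ℕ, x ^ (j + 1) / (((j + 1).factorial : ℝ) * (j + 1)) := by
  set h := dslope (fun s : ℝ => Real.exp (x * s)) 0 with h_def
  have hc : Continuous h := continuous_dslope_exp_mul x
  have hQ (s : ℝ) : HasDerivAt (fun u => ∫ t in (0:ℝ)..u, h t) (h s) s :=
    hc.integral_hasStrictDerivAt 0 s |>.hasDerivAt
  have hQc : Continuous fun u => ∫ t in (0:ℝ)..u, h t :=
    continuous_iff_continuousAt.2 fun s => (hQ s).continuousAt
  have hexp (s : ℝ) : HasDerivAt (fun u => Real.exp (x * u)) (Real.exp (x * s) * x) s := by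
    simpa using ((hasDerivAt_id s).const_mul x).exp
  have hF (s : ℝ) : s * Real.log s * (Real.exp (x * s) - h s)
      = Real.log s * ((s - 1) * Real.exp (x * s) + 1) := by
    linear_combination -Real.log s * mul_dslope_exp_mul x s
  have key := intervalIntegral.integral_eq_sub_of_hasDerivAt_of_le (a := 0) (b := 1)
    (f := fun s => s * Real.log s * (Real.exp (x * s) - h s) - Real.exp (x * s) / x
      + ∫ t in (0:ℝ)..s, h t)
    (f' := fun s => Real.log s * ((1 - x + x * s) * Real.exp (x * s))) zero_le_one
    (Continuous.continuousOn (by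
      have := Real.continuous_mul_log
      fun_prop))
    (fun s hs => by
      have hs0 : s ≠ 0 := hs.1.ne'
      simp only [hF]
      have hd := (((Real.hasDerivAt_log hs0).mul
        ((((hasDerivAt_id s).sub_const 1).mul (hexp s)).add_const 1)).sub
          ((hexp s).div_const x)).add (hQ s)
      refine hd.congr_deriv ?_
      have := mul_dslope_exp_mul x s
      rw [← h_def] at this
      have h' : h s = (Real.exp (x * s) - 1) / s := by
        rw [← this]; field_simp
      simp only [h', id, Pi.mul_apply]
      field_simp
      ring)
    (intervalIntegral.intervalIntegrable_log'.mul_continuousOn (by fun_prop))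
  rw [key, integral_dslope_exp_mul]
  simp
  ring

/-- For `x > 0`, the improper integral `∫_0^1 log(1−t)(1−xt)e^{−xt} dt` converges and equals
`(e^{−x}−1)/x + e^{−x}·Σ_{j≥1} x^j/(j!·j)`. -/
theorem integral_log_one_sub (x : ℝ) (hx : 0 < x) :
    IntervalIntegrable (fun t : ℝ => Real.log (1 - t) * (1 - x * t) * Real.exp (-x * t))
      volume 0 1 ∧
    (∫ t in (0:ℝ)..1, Real.log (1 - t) * (1 - x * t) * Real.exp (-x * t))
      = (Real.exp (-x) - 1) / x
        + Real.exp (-x) * ∑' j : ℕ, x ^ (j + 1) / (((j + 1).factorial : ℝ) * (j + 1)) := by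
  constructor
  · have hlog : IntervalIntegrable (fun t : ℝ => Real.log (1 - t)) volume 0 1 := by
      simpa using (intervalIntegral.intervalIntegrable_log' (a := 1) (b := 0)).comp_sub_left 1
    exact (hlog.mul_continuousOn (by fun_prop)).mul_continuousOn (by fun_prop)
  · have hsubst := intervalIntegral.integral_comp_sub_left (a := 0) (b := 1)
      (fun s => Real.exp (-x) * (Real.log s * ((1 - x + x * s) * Real.exp (x * s)))) 1
    rw [sub_self, sub_zero] at hsubst
    have hone : Real.exp (-x) * Real.exp x = 1 := by rw [← Real.exp_add]; simp
    calc _ = _ := intervalIntegral.integral_congr fun t _ => by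
              have : Real.exp (-x * t) = Real.exp (-x) * Real.exp (x * (1 - t)) := by
                rw [← Real.exp_add]; ring_nf
              simp only [this]
              ring
      _ = _ := hsubst
      _ = _ := by
        rw [intervalIntegral.integral_const_mul, integral_log_mul_exp x hx.ne', mul_add]
        congr 1
        field_simp
        linear_combination -hone
end

section
/- For every real x > 0, the improper integral ∫_1^∞ log(t−1)·(1−xt)·e^{−xt} dt converges and equals −e^{−x}/x + e^{−x}·(log x + γ). (Note (1−xt)e^{−xt} = d/dt (t e^{−xt}).) -/
open MeasureTheory Set

/-- The logarithmic moments of the exponential density are the derivatives of the Gamma function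
at the positive integers. -/
theorem integrableOn_and_integral_log_mul_pow_mul_exp_neg (n : ℕ) :
    IntegrableOn (fun t : ℝ => Real.log t * (t ^ n * Real.exp (-t))) (Ioi 0) ∧
      ∫ t in Ioi (0 : ℝ), Real.log t * (t ^ n * Real.exp (-t)) =
        n.factorial * (-Real.eulerMascheroniConstant + harmonic n) := by
  have hs : 0 < ((n : ℂ) + 1).re := by
    simp only [Complex.add_re, Complex.natCast_re, Complex.one_re]
    positivity
  have hcont : Continuous fun t : ℝ => (Real.exp (-t) : ℂ) := by fun_prop
  have hmellin := mellin_hasDerivAt_of_isBigO_rpow (E := ℂ) (b := 0)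
    (f := fun t : ℝ => (Real.exp (-t) : ℂ)) (s := n + 1)
    (hcont.continuousOn.locallyIntegrableOn measurableSet_Ioi)
    (by
      rw [← Asymptotics.isBigO_norm_left]
      simp_rw [Complex.norm_real, Asymptotics.isBigO_norm_left]
      simpa only [neg_one_mul] using (isLittleO_exp_neg_mul_rpow_atTop zero_lt_one _).isBigO)
    (lt_add_one _)
    (by
      simp_rw [neg_zero, Real.rpow_zero]
      exact Asymptotics.isBigO_const_of_tendsto (hcont.continuousWithinAt (x := 0)) (by simp))
    hs
  have hcast : ∀ t ∈ Ioi (0 : ℝ),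
      (t : ℂ) ^ ((n : ℂ) + 1 - 1) • (Real.log t • (Real.exp (-t) : ℂ)) =
        ((Real.log t * (t ^ n * Real.exp (-t)) : ℝ) : ℂ) := fun t _ => by
    simp only [add_sub_cancel_right, Complex.cpow_natCast, smul_eq_mul, Complex.real_smul]
    push_cast
    ring
  refine ⟨?_, ?_⟩
  · have h := ((integrableOn_congr_fun hcast measurableSet_Ioi).1 hmellin.1).re
    exact h
  · have hGamma := hmellin.2.congr_of_eventuallyEq (f₁ := Complex.Gamma) <| by
      filter_upwards [(isOpen_lt continuous_const Complex.continuous_re).mem_nhds hs] with z hz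
      rw [Complex.Gamma_eq_integral hz, Complex.GammaIntegral_eq_mellin]
    have h := hGamma.unique (Complex.hasDerivAt_Gamma_nat n)
    rw [mellin, setIntegral_congr_fun measurableSet_Ioi hcast, integral_complex_ofReal] at h
    exact_mod_cast h

/-- The moments of the exponential density, with integrability. -/
theorem integrableOn_and_integral_pow_mul_exp_neg (n : ℕ) :
    IntegrableOn (fun t : ℝ => t ^ n * Real.exp (-t)) (Ioi 0) ∧
      ∫ t in Ioi (0 : ℝ), t ^ n * Real.exp (-t) = n.factorial := by
  have hcast : ∀ t ∈ Ioi (0 : ℝ),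
      Real.exp (-t) * t ^ ((n : ℝ) + 1 - 1) = t ^ n * Real.exp (-t) := fun t _ => by
    rw [add_sub_cancel_right, Real.rpow_natCast, mul_comm]
  have hn : (0 : ℝ) < n + 1 := by positivity
  refine ⟨(integrableOn_congr_fun hcast measurableSet_Ioi).1 (Real.GammaIntegral_convergent hn), ?_⟩
  rw [← setIntegral_congr_fun measurableSet_Ioi hcast, ← Real.Gamma_eq_integral hn,
    Real.Gamma_nat_eq_factorial]

/-- For `x > 0`, the improper integral `∫_1^∞ log(t−1)(1−xt)e^{−xt} dt` converges and equals
`−e^{−x}/x + e^{−x}(log x + γ)`. -/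
theorem integral_log_sub_one (x : ℝ) (hx : 0 < x) :
    IntegrableOn (fun t : ℝ => Real.log (t - 1) * (1 - x * t) * Real.exp (-x * t))
      (Set.Ioi 1) volume ∧
    (∫ t in Set.Ioi (1:ℝ), Real.log (t - 1) * (1 - x * t) * Real.exp (-x * t))
      = -Real.exp (-x) / x
        + Real.exp (-x) * (Real.log x + Real.eulerMascheroniConstant) := by
  obtain ⟨hL0, hL0'⟩ := integrableOn_and_integral_log_mul_pow_mul_exp_neg 0
  obtain ⟨hL1, hL1'⟩ := integrableOn_and_integral_log_mul_pow_mul_exp_neg 1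
  obtain ⟨hE0, hE0'⟩ := integrableOn_and_integral_pow_mul_exp_neg 0
  obtain ⟨hE1, hE1'⟩ := integrableOn_and_integral_pow_mul_exp_neg 1
  set h : ℝ → ℝ := fun u =>
    Real.exp (-x) * (1 - x) * (Real.log u * (u ^ 0 * Real.exp (-u)))
      - Real.exp (-x) * (Real.log u * (u ^ 1 * Real.exp (-u)))
      - Real.exp (-x) * Real.log x * (1 - x) * (u ^ 0 * Real.exp (-u))
      + Real.exp (-x) * Real.log x * (u ^ 1 * Real.exp (-u)) with h_def
  have h_int : IntegrableOn h (Ioi 0) :=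
    (((hL0.const_mul _).sub (hL1.const_mul _)).sub (hE0.const_mul _)).add (hE1.const_mul _)
  have h_val : ∫ u in Ioi 0, h u =
      Real.exp (-x) * (x * (Real.log x + Real.eulerMascheroniConstant) - 1) := by
    simp only [h_def]
    rw [integral_add, integral_sub, integral_sub]
    · simp only [integral_const_mul, hL0', hL1', hE0', hE1']
      norm_num [harmonic]
      ring
    · exact hL0.const_mul _
    · exact hL1.const_mul _
    · exact (hL0.const_mul _).sub (hL1.const_mul _)
    · exact hE0.const_mul _
    · exact ((hL0.const_mul _).sub (hL1.const_mul _)).sub (hE0.const_mul _)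
    · exact hE1.const_mul _
  have hshift : ∀ s ∈ Ioi (0 : ℝ), Real.log (s + 1 - 1) * (1 - x * (s + 1)) *
      Real.exp (-x * (s + 1)) = h (x * s) := fun s hs => by
    have hexp : Real.exp (-x * (s + 1)) = Real.exp (-x) * Real.exp (-(x * s)) := by
      rw [← Real.exp_add]
      ring_nf
    simp only [h_def, hexp, add_sub_cancel_right, Real.log_mul hx.ne' (ne_of_gt hs)]
    ring
  have hmp := measurePreserving_add_right (volume : Measure ℝ) 1
  have hemb := measurableEmbedding_addRight (1 : ℝ)
  have hpre : (fun s : ℝ => s + 1) ⁻¹' Ioi 1 = Ioi 0 := by simp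
  constructor
  · rw [← hmp.integrableOn_comp_preimage hemb, hpre]
    refine (integrableOn_congr_fun hshift measurableSet_Ioi).2 ?_
    rwa [integrableOn_Ioi_comp_mul_left_iff h 0 hx, mul_zero]
  · rw [← hmp.setIntegral_preimage_emb hemb, hpre,
      setIntegral_congr_fun measurableSet_Ioi hshift, integral_comp_mul_left_Ioi h 0 hx,
      mul_zero, h_val, smul_eq_mul]
    field_simp
    ring
end

section
/- For every real x > 0, lim_{s→1⁺} (s−1) ∫_0^1 t^s (1−t)^{s−2} e^{−xt} dt = e^{−x}, where s tends to 1 from the right along the reals (the integral converges for every real s > 1). -/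
open MeasureTheory Set Filter

lemma intervalIntegrable_one_sub_rpow {r : ℝ} (hr : -1 < r) :
    IntervalIntegrable (fun t : ℝ => (1 - t) ^ r) volume 0 1 := by
  have h := (intervalIntegral.intervalIntegrable_rpow' (a := 0) (b := 1) hr).comp_sub_left 1
  simpa using h.symm

lemma integral_one_sub_rpow {r : ℝ} (hr : -1 < r) :
    ∫ t in (0:ℝ)..1, (1 - t) ^ r = (r + 1)⁻¹ := by
  rw [intervalIntegral.integral_comp_sub_left (fun t : ℝ => t ^ r) 1, integral_rpow (Or.inl hr)]
  have h : r + 1 ≠ 0 := by linarith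
  simp [Real.zero_rpow h]

lemma intervalIntegrable_rpow_mul_one_sub_rpow_mul_exp (x : ℝ) {s : ℝ} (hs : 1 < s) :
    IntervalIntegrable (fun t : ℝ => t ^ s * (1 - t) ^ (s - 2) * Real.exp (-x * t))
      volume 0 1 := by
  have hc : Continuous (fun t : ℝ => t ^ s * Real.exp (-x * t)) :=
    (Real.continuous_rpow_const (by linarith)).mul (by fun_prop)
  have h := (intervalIntegrable_one_sub_rpow (r := s - 2) (by linarith)).mul_continuousOn
    hc.continuousOn
  refine h.congr (fun t _ => ?_)
  ring

lemma abs_rpow_mul_exp_sub_exp_le {x s t : ℝ} (hx : 0 < x) (hs : 1 < s) (hs2 : s < 2)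
    (ht0 : 0 < t) (ht1 : t ≤ 1) :
    |t ^ s * Real.exp (-x * t) - Real.exp (-x)| ≤ (2 + x) * (1 - t) := by
  have hsq : t ^ 2 ≤ t ^ s := by
    rw [← Real.rpow_two]
    exact Real.rpow_le_rpow_of_exponent_ge ht0 ht1 hs2.le
  have hone : t ^ s ≤ 1 := Real.rpow_le_one ht0.le ht1 (by linarith)
  have he1 : Real.exp (-x * t) ≤ 1 := Real.exp_le_one_iff.2 (by nlinarith)
  have he0 := Real.exp_pos (-x * t)
  have hle : Real.exp (-x) ≤ Real.exp (-x * t) := Real.exp_le_exp.2 (by nlinarith)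
  have hprod : Real.exp (-x) = Real.exp (-x * t) * Real.exp (-x * (1 - t)) := by
    rw [← Real.exp_add]; ring_nf
  have hlin := Real.add_one_le_exp (-x * (1 - t))
  have hx1 : 0 ≤ x * (1 - t) := mul_nonneg hx.le (by linarith)
  have hdiff : Real.exp (-x * t) - Real.exp (-x) ≤ x * (1 - t) := by
    rw [hprod]; nlinarith
  have hpow : 1 - t ^ s ≤ 2 * (1 - t) := by nlinarith [sq_nonneg (1 - t)]
  rw [abs_le]
  constructor <;> nlinarith

lemma abs_mul_integral_sub_exp_le {x s : ℝ} (hx : 0 < x) (hs : 1 < s) (hs2 : s < 2) :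
    |(s - 1) * (∫ t in (0:ℝ)..1, t ^ s * (1 - t) ^ (s - 2) * Real.exp (-x * t)) - Real.exp (-x)|
      ≤ (s - 1) * (2 + x) := by
  have hne : s - 1 ≠ 0 := by linarith
  have hexp : Real.exp (-x) = (s - 1) * ∫ t in (0:ℝ)..1, (1 - t) ^ (s - 2) * Real.exp (-x) := by
    rw [intervalIntegral.integral_mul_const, integral_one_sub_rpow (by linarith),
      show s - 2 + 1 = s - 1 by ring, mul_inv_cancel_left₀ hne]
  have hbound : ∀ t ∈ uIoc (0:ℝ) 1, ‖t ^ s * (1 - t) ^ (s - 2) * Real.exp (-x * t)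
      - (1 - t) ^ (s - 2) * Real.exp (-x)‖ ≤ 2 + x := by
    intro t ht
    rw [uIoc_of_le zero_le_one] at ht
    obtain ⟨ht0, ht1⟩ := ht
    have hfac : t ^ s * (1 - t) ^ (s - 2) * Real.exp (-x * t) - (1 - t) ^ (s - 2) * Real.exp (-x)
        = (1 - t) ^ (s - 2) * (t ^ s * Real.exp (-x * t) - Real.exp (-x)) := by ring
    have hu : 0 ≤ 1 - t := by linarith
    have hpow : (1 - t) ^ (s - 2) * (1 - t) ≤ 1 := by
      rw [← Real.rpow_add_one' hu (by linarith)]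
      exact Real.rpow_le_one hu (by linarith) (by linarith)
    rw [hfac, Real.norm_eq_abs, abs_mul, abs_of_nonneg (Real.rpow_nonneg hu _)]
    calc _ ≤ (1 - t) ^ (s - 2) * ((2 + x) * (1 - t)) := by
            gcongr
            exact abs_rpow_mul_exp_sub_exp_le hx hs hs2 ht0 ht1
      _ ≤ 2 + x := by nlinarith
  have hint := intervalIntegral.norm_integral_le_of_norm_le_const hbound
  rw [intervalIntegral.integral_sub (intervalIntegrable_rpow_mul_one_sub_rpow_mul_exp x hs)
    ((intervalIntegrable_one_sub_rpow (by linarith)).mul_const _), Real.norm_eq_abs] at hint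
  rw [hexp, ← mul_sub, abs_mul, abs_of_pos (sub_pos.2 hs)]
  simp only [sub_zero, abs_one, mul_one] at hint
  gcongr

/-- For `x > 0`: the integral `∫_0^1 t^s (1−t)^{s−2} e^{−xt} dt` converges for every real `s > 1`
and `lim_{s→1⁺} (s−1)∫_0^1 t^s (1−t)^{s−2} e^{−xt} dt = e^{−x}`. -/
theorem whittakerM_regularized_value (x : ℝ) (hx : 0 < x) :
    (∀ s : ℝ, 1 < s →
      IntervalIntegrable (fun t : ℝ => t ^ s * (1 - t) ^ (s - 2) * Real.exp (-x * t))
        volume 0 1) ∧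
    Tendsto (fun s : ℝ =>
        (s - 1) * ∫ t in (0:ℝ)..1, t ^ s * (1 - t) ^ (s - 2) * Real.exp (-x * t))
      (nhdsWithin 1 (Set.Ioi 1)) (nhds (Real.exp (-x))) := by
  refine ⟨fun s hs => intervalIntegrable_rpow_mul_one_sub_rpow_mul_exp x hs, ?_⟩
  rw [tendsto_iff_norm_sub_tendsto_zero]
  have hlim : Tendsto (fun s : ℝ => (s - 1) * (2 + x)) (nhdsWithin 1 (Ioi 1)) (nhds 0) := by
    have hc : Continuous (fun s : ℝ => (s - 1) * (2 + x)) := by fun_prop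
    simpa using (hc.tendsto 1).mono_left nhdsWithin_le_nhds
  refine squeeze_zero' (Eventually.of_forall fun _ => norm_nonneg _) ?_ hlim
  filter_upwards [Ioo_mem_nhdsGT (one_lt_two : (1:ℝ) < 2)] with s hs
  exact abs_mul_integral_sub_exp_le hx hs.1 hs.2
end

section
/- For every real x > 0, lim_{s→1⁺} (s−1) ∫_1^∞ t^s (t−1)^{s−2} e^{−xt} dt = e^{−x}, where s tends to 1 from the right along the reals (the integral converges for every real s > 1). -/
open MeasureTheory Set Filter

/-- The integrand of the Gamma integral is integrable on the positive half-line. -/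
lemma integrableOn_rpow_sub_one_mul_exp_neg_mul {a r : ℝ} (ha : 0 < a) (hr : 0 < r) :
    IntegrableOn (fun t : ℝ => t ^ (a - 1) * Real.exp (-(r * t))) (Ioi 0) := by
  simpa using integrableOn_rpow_mul_exp_neg_mul_rpow (s := a - 1) (by linarith) one_pos hr

lemma add_one_rpow_le {u s : ℝ} (hu : 0 ≤ u) (hs : 0 ≤ s) :
    (u + 1) ^ s ≤ 2 ^ s * (1 + u ^ s) := by
  have h₁ : (u + 1) ^ s ≤ (2 * max 1 u) ^ s := by
    refine Real.rpow_le_rpow (by linarith) ?_ hs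
    linarith [le_max_left 1 u, le_max_right 1 u]
  rw [Real.mul_rpow two_pos.le (by positivity)] at h₁
  refine h₁.trans (mul_le_mul_of_nonneg_left ?_ (by positivity))
  rcases max_choice 1 u with h | h <;> rw [h]
  · simpa using Real.rpow_nonneg hu s
  · linarith

lemma integrableOn_shifted_whittakerW {x s : ℝ} (hx : 0 < x) (hs : 1 < s) :
    IntegrableOn (fun u : ℝ => (u + 1) ^ s * u ^ (s - 2) * Real.exp (-x * (u + 1)))
      (Ioi 0) := by
  have h₁ := integrableOn_rpow_sub_one_mul_exp_neg_mul (a := s - 1) (by linarith) hx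
  have h₂ := integrableOn_rpow_sub_one_mul_exp_neg_mul (a := 2 * s - 1) (by linarith) hx
  refine ((h₁.add h₂).const_mul (2 ^ s * Real.exp (-x))).mono' ?_ ?_
  · exact Measurable.aestronglyMeasurable (by fun_prop)
  · filter_upwards [ae_restrict_mem measurableSet_Ioi] with u hu
    have hu : 0 < u := hu
    rw [Real.norm_of_nonneg (by positivity)]
    have hsum : u ^ (2 * s - 1 - 1) = u ^ s * u ^ (s - 2) := by
      rw [← Real.rpow_add hu]; ring_nf
    have hexp : Real.exp (-x * (u + 1)) = Real.exp (-x) * Real.exp (-(x * u)) := by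
      rw [← Real.exp_add]; ring_nf
    calc _ ≤ 2 ^ s * (1 + u ^ s) * u ^ (s - 2) * Real.exp (-x * (u + 1)) := by
          gcongr
          exact add_one_rpow_le hu.le (by linarith)
      _ = _ := by
          simp only [Pi.add_apply]
          rw [hsum, hexp, show s - 1 - 1 = s - 2 by ring]
          ring

lemma integral_whittakerW_eq_shifted (x s : ℝ) :
    ∫ t in Ioi (1 : ℝ), t ^ s * (t - 1) ^ (s - 2) * Real.exp (-x * t) =
      ∫ u in Ioi (0 : ℝ), (u + 1) ^ s * u ^ (s - 2) * Real.exp (-x * (u + 1)) := by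
  rw [← (measurePreserving_add_right volume (1 : ℝ)).setIntegral_preimage_emb
    (measurableEmbedding_addRight 1)]
  simp

lemma integrableOn_whittakerW {x s : ℝ} (hx : 0 < x) (hs : 1 < s) :
    IntegrableOn (fun t : ℝ => t ^ s * (t - 1) ^ (s - 2) * Real.exp (-x * t)) (Ioi 1) := by
  rw [← (measurePreserving_add_right volume (1 : ℝ)).integrableOn_comp_preimage
    (measurableEmbedding_addRight 1)]
  simpa [Function.comp_def] using integrableOn_shifted_whittakerW hx hs

lemma mul_integral_whittakerW_ge {x s : ℝ} (hx : 0 < x) (hs : 1 < s) :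
    Real.exp (-x) * ((1 / x) ^ (s - 1) * Real.Gamma s) ≤
      (s - 1) * ∫ t in Ioi (1 : ℝ), t ^ s * (t - 1) ^ (s - 2) * Real.exp (-x * t) := by
  have hs' : 0 < s - 1 := by linarith
  have hΓ : Real.Gamma s = (s - 1) * Real.Gamma (s - 1) := by
    simpa using Real.Gamma_add_one hs'.ne'
  have hle : ∫ u in Ioi (0 : ℝ), Real.exp (-x) * (u ^ (s - 1 - 1) * Real.exp (-(x * u))) ≤
      ∫ u in Ioi (0 : ℝ), (u + 1) ^ s * u ^ (s - 2) * Real.exp (-x * (u + 1)) := by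
    refine setIntegral_mono_on
      ((integrableOn_rpow_sub_one_mul_exp_neg_mul hs' hx).const_mul _)
      (integrableOn_shifted_whittakerW hx hs) measurableSet_Ioi fun u hu => ?_
    have hu : 0 < u := hu
    have hexp : Real.exp (-x * (u + 1)) = Real.exp (-x) * Real.exp (-(x * u)) := by
      rw [← Real.exp_add]; ring_nf
    have h1 : 1 ≤ (u + 1) ^ s := Real.one_le_rpow (by linarith) (by linarith)
    rw [hexp, show s - 1 - 1 = s - 2 by ring]
    calc _ = 1 * u ^ (s - 2) * (Real.exp (-x) * Real.exp (-(x * u))) := by ring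
      _ ≤ _ := by gcongr
  rw [integral_const_mul, Real.integral_rpow_mul_exp_neg_mul_Ioi hs' hx] at hle
  rw [integral_whittakerW_eq_shifted, hΓ]
  calc _ = (s - 1) * (Real.exp (-x) * ((1 / x) ^ (s - 1) * Real.Gamma (s - 1))) := by ring
    _ ≤ _ := by gcongr

lemma mul_integral_whittakerW_le {x s : ℝ} (hx : 0 < x) (hs : 1 < s) (hs2 : s ≤ 2) :
    (s - 1) * ∫ t in Ioi (1 : ℝ), t ^ s * (t - 1) ^ (s - 2) * Real.exp (-x * t) ≤
      Real.exp (-x) * ((1 / x) ^ (s - 1) * Real.Gamma s + (s - 1) *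
        (2 * ((1 / x) ^ s * Real.Gamma s) + (1 / x) ^ (s + 1) * Real.Gamma (s + 1))) := by
  have hs' : 0 < s - 1 := by linarith
  have hs₀ : 0 < s := by linarith
  have hs₁ : 0 < s + 1 := by linarith
  have hΓ : (s - 1) * Real.Gamma (s - 1) = Real.Gamma s := by
    simpa using (Real.Gamma_add_one hs'.ne').symm
  have i₀ := integrableOn_rpow_sub_one_mul_exp_neg_mul hs' hx
  have i₁ := (integrableOn_rpow_sub_one_mul_exp_neg_mul hs₀ hx).const_mul 2
  have i₂ := integrableOn_rpow_sub_one_mul_exp_neg_mul hs₁ hx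
  have hle : ∫ u in Ioi (0 : ℝ), (u + 1) ^ s * u ^ (s - 2) * Real.exp (-x * (u + 1)) ≤
      ∫ u in Ioi (0 : ℝ), Real.exp (-x) * (u ^ (s - 1 - 1) * Real.exp (-(x * u)) +
        (2 * (u ^ (s - 1) * Real.exp (-(x * u))) +
          u ^ (s + 1 - 1) * Real.exp (-(x * u)))) := by
    refine setIntegral_mono_on (integrableOn_shifted_whittakerW hx hs)
      ((i₀.add (i₁.add i₂)).const_mul _) measurableSet_Ioi fun u hu => ?_
    have hu : 0 < u := hu
    have hexp : Real.exp (-x * (u + 1)) = Real.exp (-x) * Real.exp (-(x * u)) := by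
      rw [← Real.exp_add]; ring_nf
    have h2 : (u + 1) ^ s ≤ (u + 1) ^ 2 := by
      rw [← Real.rpow_two]
      exact Real.rpow_le_rpow_of_exponent_le (by linarith) hs2
    have e₁ : u ^ (s - 1) = u ^ (s - 2) * u := by
      rw [← Real.rpow_add_one hu.ne']; ring_nf
    have e₂ : u ^ (s + 1 - 1) = u ^ (s - 2) * u ^ 2 := by
      rw [← Real.rpow_two, ← Real.rpow_add hu]; ring_nf
    rw [hexp, e₁, e₂, show s - 1 - 1 = s - 2 by ring]
    calc _ ≤ (u + 1) ^ 2 * u ^ (s - 2) * (Real.exp (-x) * Real.exp (-(x * u))) := by gcongr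
      _ = _ := by ring
  rw [integral_const_mul, integral_add i₀ (i₁.fun_add i₂), integral_add i₁ i₂, integral_const_mul,
    Real.integral_rpow_mul_exp_neg_mul_Ioi hs' hx, Real.integral_rpow_mul_exp_neg_mul_Ioi hs₀ hx,
    Real.integral_rpow_mul_exp_neg_mul_Ioi hs₁ hx] at hle
  rw [integral_whittakerW_eq_shifted]
  refine (mul_le_mul_of_nonneg_left hle hs'.le).trans_eq ?_
  linear_combination Real.exp (-x) * (1 / x) ^ (s - 1) * hΓ

/-- For `x > 0`: the integral `∫_1^∞ t^s (t−1)^{s−2} e^{−xt} dt` converges for every real `s > 1`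
and `lim_{s→1⁺} (s−1)∫_1^∞ t^s (t−1)^{s−2} e^{−xt} dt = e^{−x}`. -/
theorem whittakerW_regularized_value (x : ℝ) (hx : 0 < x) :
    (∀ s : ℝ, 1 < s →
      IntegrableOn (fun t : ℝ => t ^ s * (t - 1) ^ (s - 2) * Real.exp (-x * t))
        (Set.Ioi 1) volume) ∧
    Tendsto (fun s : ℝ =>
        (s - 1) * ∫ t in Set.Ioi (1:ℝ), t ^ s * (t - 1) ^ (s - 2) * Real.exp (-x * t))
      (nhdsWithin 1 (Set.Ioi 1)) (nhds (Real.exp (-x))) := by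
  refine ⟨fun s hs => integrableOn_whittakerW hx hs, ?_⟩
  have hΓ : ∀ a : ℝ, 0 < a → ContinuousAt Real.Gamma a := fun a ha =>
    (Real.differentiableAt_Gamma fun m => by
      have : (0 : ℝ) ≤ m := m.cast_nonneg
      linarith).continuousAt
  have hΓ₁ : ContinuousAt (fun s : ℝ => Real.Gamma s) 1 := hΓ 1 one_pos
  have hΓ₂ : ContinuousAt (fun s : ℝ => Real.Gamma (s + 1)) 1 :=
    ContinuousAt.comp (g := Real.Gamma) (hΓ (1 + 1) (by norm_num))
      (continuous_add_const 1).continuousAt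
  have hpow : ∀ c : ℝ, ContinuousAt (fun s : ℝ => (1 / x) ^ (s + c)) 1 := fun c =>
    ContinuousAt.rpow continuousAt_const (by fun_prop) (Or.inl (by positivity))
  have hlow : ContinuousAt (fun s : ℝ =>
      Real.exp (-x) * ((1 / x) ^ (s - 1) * Real.Gamma s)) 1 :=
    continuousAt_const.mul ((hpow (-1)).mul hΓ₁)
  have hpow₀ : ContinuousAt (fun s : ℝ => (1 / x) ^ s) 1 := by simpa using hpow 0
  have hup : ContinuousAt (fun s : ℝ =>
      Real.exp (-x) * ((1 / x) ^ (s - 1) * Real.Gamma s + (s - 1) *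
        (2 * ((1 / x) ^ s * Real.Gamma s) + (1 / x) ^ (s + 1) * Real.Gamma (s + 1)))) 1 :=
    continuousAt_const.mul (((hpow (-1)).mul hΓ₁).add ((by fun_prop : ContinuousAt
      (fun s : ℝ => s - 1) 1).mul ((continuousAt_const.mul (hpow₀.mul hΓ₁)).add
        ((hpow 1).mul hΓ₂))))
  refine tendsto_of_tendsto_of_tendsto_of_le_of_le'
    (by simpa using hlow.tendsto.mono_left nhdsWithin_le_nhds)
    (by simpa using hup.tendsto.mono_left nhdsWithin_le_nhds) ?_ ?_
  · filter_upwards [self_mem_nhdsWithin] with s hs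
    simpa using mul_integral_whittakerW_ge hx hs
  · filter_upwards [Ioc_mem_nhdsGT one_lt_two] with s hs
    simpa using mul_integral_whittakerW_le hx hs.1 hs.2
end

section
/- For every real x > 0, lim_{s→1⁺} [ (s−1) ∫_0^1 t^s (1−t)^{s−2} e^{−xt} dt − e^{−x} ] / (s−1) = ∫_0^1 log(1−t)·(1−xt)·e^{−xt} dt, where s tends to 1 from the right along the reals. (That is, the function h(s) := (s−1)∫_0^1 t^s(1−t)^{s−2}e^{−xt}dt has one-sided derivative at s = 1 equal to ∫_0^1 log(1−t)·d/dt(t e^{−xt}) dt.) -/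
open MeasureTheory Set Filter

/-- Integration by parts against the primitive `(1 - (1 - t) ^ (s - 1)) / (s - 1)` of
`(1 - t) ^ (s - 2)`. -/
theorem integral_mul_one_sub_rpow_eq {u u' : ℝ → ℝ} {s : ℝ} (hs : 1 < s)
    (hu : ∀ t, HasDerivAt u (u' t) t) (hu' : Continuous u') (hu0 : u 0 = 0) :
    ((s - 1) * (∫ t in (0:ℝ)..1, u t * (1 - t) ^ (s - 2)) - u 1) / (s - 1)
      = ∫ t in (0:ℝ)..1, ((1 - t) ^ (s - 1) - 1) / (s - 1) * u' t := by
  have hs0 : s - 1 ≠ 0 := by linarith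
  have hcont : Continuous fun t : ℝ => (1 - (1 - t) ^ (s - 1)) / (s - 1) := by
    have : Continuous fun t : ℝ => (1 - t) ^ (s - 1) :=
      (by fun_prop : Continuous fun t : ℝ => 1 - t).rpow_const fun _ => Or.inr (by linarith)
    fun_prop
  have hint : IntervalIntegrable (fun t : ℝ => (1 - t) ^ (s - 2)) volume 0 1 := by
    have h := (intervalIntegral.intervalIntegrable_rpow' (a := 0) (b := 1)
      (by linarith : -1 < s - 2)).comp_sub_left 1
    simpa using h.symm
  have key := intervalIntegral.integral_mul_deriv_eq_deriv_mul_of_hasDeriv_right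
    (a := 0) (b := 1) (u := u) (u' := u')
    (v := fun t : ℝ => (1 - (1 - t) ^ (s - 1)) / (s - 1)) (v' := fun t : ℝ => (1 - t) ^ (s - 2))
    (fun t _ => (hu t).continuousAt.continuousWithinAt) hcont.continuousOn
    (fun t _ => (hu t).hasDerivWithinAt)
    (fun t ht => by
      rw [min_eq_left zero_le_one, max_eq_right zero_le_one] at ht
      have h1 : 1 - t ≠ 0 := by linarith [ht.2]
      have h := ((((hasDerivAt_id t).const_sub 1).rpow_const (p := s - 1)
        (Or.inl h1)).const_sub 1).div_const (s - 1)
      refine HasDerivAt.hasDerivWithinAt (h.congr_deriv ?_)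
      rw [show s - 1 - 1 = s - 2 by ring]
      simp only [id]
      field_simp)
    (hu'.intervalIntegrable _ _) hint
  have hneg : (∫ t in (0:ℝ)..1, ((1 - t) ^ (s - 1) - 1) / (s - 1) * u' t)
      = -∫ t in (0:ℝ)..1, u' t * ((1 - (1 - t) ^ (s - 1)) / (s - 1)) := by
    rw [← intervalIntegral.integral_neg]
    congr 1
    ext t
    ring
  rw [key, hneg, hu0, sub_self, Real.zero_rpow hs0]
  field_simp
  ring

theorem abs_rpow_sub_one_div_le_neg_log {a ε : ℝ} (ha : 0 < a) (ha1 : a ≤ 1) (hε : 0 < ε) :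
    |(a ^ ε - 1) / ε| ≤ -Real.log a := by
  have h1 : a ^ ε ≤ 1 := Real.rpow_le_one ha.le ha1 hε.le
  rw [abs_of_nonpos (div_nonpos_of_nonpos_of_nonneg (by linarith) hε.le), neg_le_neg_iff,
    le_div_iff₀ hε, Real.rpow_def_of_pos ha]
  linarith [Real.add_one_le_exp (Real.log a * ε)]

theorem tendsto_rpow_sub_one_div_nhdsGT_one {a : ℝ} (ha : 0 < a) :
    Tendsto (fun s : ℝ => (a ^ (s - 1) - 1) / (s - 1)) (nhdsWithin 1 (Ioi 1))
      (nhds (Real.log a)) := by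
  have h : HasDerivAt (fun s : ℝ => a ^ (s - 1)) (Real.log a) 1 := by
    simpa using ((hasDerivAt_id (1 : ℝ)).sub_const 1).const_rpow ha
  have h2 := (hasDerivAt_iff_tendsto_slope.1 h).mono_left
    (nhdsWithin_mono 1 fun y (hy : 1 < y) => hy.ne')
  refine h2.congr fun s => ?_
  simp [slope_def_field]

/-- For `x > 0`, the function `h(s) := (s−1)∫_0^1 t^s(1−t)^{s−2}e^{−xt}dt` has one-sided
derivative at `s = 1` equal to `∫_0^1 log(1−t)·(1−xt)·e^{−xt} dt`. -/
theorem whittakerM_regularized_derivative (x : ℝ) (hx : 0 < x) :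
    Tendsto (fun s : ℝ =>
        ((s - 1) * (∫ t in (0:ℝ)..1, t ^ s * (1 - t) ^ (s - 2) * Real.exp (-x * t))
          - Real.exp (-x)) / (s - 1))
      (nhdsWithin 1 (Set.Ioi 1))
      (nhds (∫ t in (0:ℝ)..1, Real.log (1 - t) * (1 - x * t) * Real.exp (-x * t))) := by
  have hparts : ∀ s ∈ Ioi (1 : ℝ),
      (∫ t in (0:ℝ)..1, ((1 - t) ^ (s - 1) - 1) / (s - 1) *
          ((s * t ^ (s - 1) - x * t ^ s) * Real.exp (-x * t)))
        = ((s - 1) * (∫ t in (0:ℝ)..1, t ^ s * (1 - t) ^ (s - 2) * Real.exp (-x * t))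
          - Real.exp (-x)) / (s - 1) := by
    intro s hs
    have hs : 1 < s := hs
    have hcont : ∀ p : ℝ, 0 ≤ p → Continuous fun t : ℝ => t ^ p := fun p hp =>
      continuous_id.rpow_const fun _ => Or.inr hp
    have h := integral_mul_one_sub_rpow_eq (u := fun t => t ^ s * Real.exp (-x * t))
      (u' := fun t => (s * t ^ (s - 1) - x * t ^ s) * Real.exp (-x * t)) hs
      (fun t => by
        have h := (Real.hasDerivAt_rpow_const (x := t) (Or.inr hs.le)).mul
          (((hasDerivAt_id t).const_mul (-x)).exp)
        refine h.congr_deriv ?_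
        simp only [id]
        ring)
      (by
        have := hcont (s - 1) (by linarith)
        have := hcont s (by linarith)
        fun_prop)
      (by simp [Real.zero_rpow (by linarith : s ≠ 0)])
    simp only [Real.one_rpow, mul_one, one_mul] at h
    rw [← h]
    simp only [mul_right_comm]
  refine Tendsto.congr' (eventually_nhdsWithin_of_forall hparts) ?_
  have hne : ∀ᵐ t : ℝ, t ≠ 1 := by simp [ae_iff]
  refine intervalIntegral.tendsto_integral_filter_of_dominated_convergence
    (fun t => -Real.log (1 - t) * (2 + x)) ?_ ?_ ?_ ?_
  · refine Eventually.of_forall fun s => Measurable.aestronglyMeasurable ?_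
    fun_prop
  · have h2 : ∀ᶠ s in nhdsWithin (1 : ℝ) (Ioi 1), s ∈ Ioo (1 : ℝ) 2 :=
      Ioo_mem_nhdsGT (by norm_num)
    filter_upwards [h2] with s hs
    filter_upwards [hne] with t ht1 ht
    rw [uIoc_of_le zero_le_one] at ht
    have hlt : t < 1 := lt_of_le_of_ne ht.2 ht1
    rw [norm_mul]
    have hA := abs_rpow_sub_one_div_le_neg_log (a := 1 - t) (ε := s - 1) (by linarith)
      (by linarith [ht.1]) (by linarith [hs.1])
    refine mul_le_mul hA ?_ (norm_nonneg _) ((abs_nonneg _).trans hA)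
    have hexp : Real.exp (-x * t) ≤ 1 := Real.exp_le_one_iff.2 (by nlinarith [ht.1])
    have hp (p : ℝ) (hp : 0 ≤ p) : 0 ≤ t ^ p ∧ t ^ p ≤ 1 :=
      ⟨Real.rpow_nonneg ht.1.le _, Real.rpow_le_one ht.1.le ht.2 hp⟩
    obtain ⟨ha0, ha1⟩ := hp (s - 1) (by linarith [hs.1])
    obtain ⟨hb0, hb1⟩ := hp s (by linarith [hs.1])
    rw [norm_mul, Real.norm_eq_abs, Real.norm_eq_abs, Real.abs_exp]
    refine (mul_le_of_le_one_right (abs_nonneg _) hexp).trans ?_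
    rw [abs_le]
    constructor <;> nlinarith [hs.1, hs.2]
  · have h := (intervalIntegral.intervalIntegrable_log' (a := 0) (b := 1)).comp_sub_left 1
    have h : IntervalIntegrable (fun t : ℝ => Real.log (1 - t)) volume 0 1 := by
      simpa using h.symm
    exact h.neg.mul_const _
  · filter_upwards [hne] with t ht1 ht
    rw [uIoc_of_le zero_le_one] at ht
    have hlt : t < 1 := lt_of_le_of_ne ht.2 ht1
    have hcs : Continuous fun s : ℝ => (s * t ^ (s - 1) - x * t ^ s) * Real.exp (-x * t) := by
      have h1 : Continuous fun s : ℝ => t ^ s :=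
        Real.continuous_const_rpow ht.1.ne'
      have h2 : Continuous fun s : ℝ => t ^ (s - 1) :=
        h1.comp (by fun_prop : Continuous fun s : ℝ => s - 1)
      fun_prop
    have h := (tendsto_rpow_sub_one_div_nhdsGT_one (a := 1 - t) (by linarith)).mul
      ((hcs.tendsto 1).mono_left nhdsWithin_le_nhds)
    simpa [mul_assoc] using h
end

section
/- For every real x > 0, lim_{s→1⁺} [ (s−1) ∫_1^∞ t^s (t−1)^{s−2} e^{−xt} dt − e^{−x} ] / (s−1) = −∫_1^∞ log(t−1)·(1−xt)·e^{−xt} dt, where s tends to 1 from the right along the reals. (That is, the function h(s) := (s−1)∫_1^∞ t^s(t−1)^{s−2}e^{−xt}dt has one-sided derivative at s = 1 equal to −∫_1^∞ log(t−1)·d/dt(t e^{−xt}) dt.) -/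
open MeasureTheory Set Filter

section

variable {x : ℝ}

/-- Gamma-type integrals shifted to `(1, ∞)` converge. -/
theorem integrableOn_pow_mul_sub_one_rpow_mul_exp (hx : 0 < x) (k : ℕ) {p : ℝ} (hp : -1 < p) :
    IntegrableOn (fun t : ℝ => t ^ k * (t - 1) ^ p * Real.exp (-x * t)) (Ioi 1) := by
  induction k generalizing p with
  | zero =>
    have h := integrableOn_rpow_mul_exp_neg_mul_rpow hp one_pos hx
    have h2 := ((measurePreserving_sub_right volume (1 : ℝ)).integrableOn_comp_preimage
      (Homeomorph.subRight (1 : ℝ)).measurableEmbedding).2 h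
    have hpre : (fun t : ℝ => t - 1) ⁻¹' Ioi 0 = Ioi 1 := by
      ext t
      simp
    rw [hpre] at h2
    refine IntegrableOn.congr_fun (h2.mul_const (Real.exp (-x))) (fun t _ => ?_)
      measurableSet_Ioi
    simp only [Function.comp_apply, Real.rpow_one, pow_zero, one_mul]
    rw [mul_assoc, ← Real.exp_add]
    congr 2
    ring
  | succ k ih =>
    refine IntegrableOn.congr_fun ((ih (p := p + 1) (by linarith)).add (ih hp)) (fun t ht => ?_)
      measurableSet_Ioi
    have ht0 : 0 < t - 1 := sub_pos.2 ht
    simp only [Pi.add_apply]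
    rw [Real.rpow_add_one ht0.ne']
    ring

theorem integrableOn_of_abs_le_pow_mul_sub_one_rpow_mul_exp (hx : 0 < x) (k : ℕ) {p C : ℝ}
    (hp : -1 < p) {f : ℝ → ℝ} (hf : Measurable f)
    (hle : ∀ t : ℝ, 1 < t → |f t| ≤ C * t ^ k * (t - 1) ^ p) :
    IntegrableOn (fun t => f t * Real.exp (-x * t)) (Ioi 1) := by
  refine ((integrableOn_pow_mul_sub_one_rpow_mul_exp hx k hp).const_mul C).mono'
    (by fun_prop) ?_
  refine (ae_restrict_iff' measurableSet_Ioi).2 (Eventually.of_forall fun t ht => ?_)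
  rw [Real.norm_eq_abs, abs_mul, Real.abs_exp]
  calc |f t| * Real.exp (-x * t) ≤ (C * t ^ k * (t - 1) ^ p) * Real.exp (-x * t) := by
        gcongr
        exact hle t ht
    _ = _ := by ring

theorem integral_Ioi_eq_neg_of_hasDerivAt {f f' : ℝ → ℝ} {a : ℝ}
    (hcont : ContinuousWithinAt f (Ici a) a) (hderiv : ∀ t ∈ Ioi a, HasDerivAt f (f' t) t)
    (hf' : IntegrableOn f' (Ioi a)) (hf : IntegrableOn f (Ioi a)) :
    ∫ t in Ioi a, f' t = -f a := by
  rw [integral_Ioi_of_hasDerivAt_of_tendsto hcont hderiv hf'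
    (tendsto_zero_of_hasDerivAt_of_integrableOn_Ioi hderiv hf' hf), zero_sub]

theorem hasDerivAt_exp_neg_mul (x t : ℝ) :
    HasDerivAt (fun t => Real.exp (-x * t)) (Real.exp (-x * t) * -x) t := by
  simpa using ((hasDerivAt_id t).const_mul (-x)).exp

theorem integral_mul_sub_one_mul_exp (hx : 0 < x) :
    ∫ t in Ioi (1 : ℝ), (x * t - 1) * Real.exp (-x * t) = Real.exp (-x) := by
  have h := integral_Ioi_eq_neg_of_hasDerivAt (a := 1) (f := fun t => -t * Real.exp (-x * t))
    (f' := fun t => (x * t - 1) * Real.exp (-x * t))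
    (by fun_prop)
    (fun t _ => by
      convert! (hasDerivAt_id t).neg.mul (hasDerivAt_exp_neg_mul x t) using 1
      simp only [Pi.neg_apply, id]
      ring)
    (integrableOn_of_abs_le_pow_mul_sub_one_rpow_mul_exp hx 1 (p := 0) (C := x + 1) (by norm_num)
      (by fun_prop) fun t ht => by
        rw [Real.rpow_zero, abs_le]
        constructor <;> nlinarith [mul_pos hx (zero_lt_one.trans ht)])
    (integrableOn_of_abs_le_pow_mul_sub_one_rpow_mul_exp hx 1 (p := 0) (C := 1) (by norm_num)
      (by fun_prop) fun t ht => by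
        rw [Real.rpow_zero, abs_le]
        constructor <;> linarith)
  rw [h]
  simp

theorem integrableOn_deriv_mul_log_mul_exp (hx : 0 < x) :
    IntegrableOn (fun t : ℝ => (Real.log t + 1 - x * t * Real.log t) * Real.exp (-x * t))
      (Ioi 1) := by
  refine integrableOn_of_abs_le_pow_mul_sub_one_rpow_mul_exp hx 2 (p := 0) (C := x + 2)
    (by norm_num) (by fun_prop) fun t ht => ?_
  have h0 : 0 ≤ Real.log t := Real.log_nonneg ht.le
  have h1 : Real.log t ≤ t := Real.log_le_self (by linarith)
  have h2 : 0 ≤ x * t := by positivity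
  have h3 : x * t * Real.log t ≤ x * t * t := by gcongr
  have h4 : 0 ≤ x * t * Real.log t := by positivity
  rw [Real.rpow_zero, abs_le]
  constructor <;> nlinarith

theorem integral_deriv_mul_log_mul_exp (hx : 0 < x) :
    ∫ t in Ioi (1 : ℝ), (Real.log t + 1 - x * t * Real.log t) * Real.exp (-x * t) = 0 := by
  have h := integral_Ioi_eq_neg_of_hasDerivAt (a := 1)
    (f := fun t => t * Real.log t * Real.exp (-x * t))
    (f' := fun t => (Real.log t + 1 - x * t * Real.log t) * Real.exp (-x * t))
    (ContinuousAt.continuousWithinAt <|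
      (continuousAt_id.mul (Real.continuousAt_log one_ne_zero)).mul (by fun_prop))
    (fun t ht => by
      have ht0 : t ≠ 0 := (zero_lt_one.trans ht).ne'
      convert! ((hasDerivAt_id t).mul (Real.hasDerivAt_log ht0)).mul
        (hasDerivAt_exp_neg_mul x t) using 1
      simp only [Pi.mul_apply, id]
      field_simp
      ring)
    (integrableOn_deriv_mul_log_mul_exp hx)
    (integrableOn_of_abs_le_pow_mul_sub_one_rpow_mul_exp hx 2 (p := 0) (C := 1) (by norm_num)
      (by fun_prop) fun t ht => by
        have h0 : 0 ≤ Real.log t := Real.log_nonneg ht.le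
        have h1 : Real.log t ≤ t := Real.log_le_self (by linarith)
        rw [Real.rpow_zero, abs_of_nonneg (by positivity)]
        nlinarith)
  rw [h]
  simp

/-- Integration by parts removing the singular factor `(t - 1) ^ (s - 2)`. -/
theorem sub_one_mul_integral_rpow_mul_exp (hx : 0 < x) {s : ℝ} (hs : 1 < s) (hs2 : s < 2) :
    (s - 1) * ∫ t in Ioi (1 : ℝ), t ^ s * (t - 1) ^ (s - 2) * Real.exp (-x * t) =
      ∫ t in Ioi (1 : ℝ), (t * (t - 1)) ^ (s - 1) * (x * t - s) * Real.exp (-x * t) := by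
  have hpow : ∀ t : ℝ, 1 < t → t ^ s ≤ t ^ 2 := fun t ht => by
    rw [← Real.rpow_natCast]
    exact Real.rpow_le_rpow_of_exponent_le ht.le (by exact_mod_cast hs2.le)
  have hA : IntegrableOn (fun t : ℝ => t ^ s * (t - 1) ^ (s - 2) * Real.exp (-x * t)) (Ioi 1) :=
    integrableOn_of_abs_le_pow_mul_sub_one_rpow_mul_exp hx 2 (p := s - 2) (C := 1) (by linarith)
      (by fun_prop) fun t ht => by
        have h0 : 0 < t := by linarith
        have h1 : 0 < t - 1 := by linarith
        rw [abs_of_nonneg (by positivity), one_mul]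
        gcongr
        exact hpow t ht
  have hB : IntegrableOn
      (fun t : ℝ => (t * (t - 1)) ^ (s - 1) * (x * t - s) * Real.exp (-x * t)) (Ioi 1) :=
    integrableOn_of_abs_le_pow_mul_sub_one_rpow_mul_exp hx 2 (p := s - 1) (C := x + 2)
      (by linarith) (by fun_prop) fun t ht => by
        have h0 : 0 < t := by linarith
        have h1 : 0 < t - 1 := by linarith
        have h2 : |x * t - s| ≤ (x + 2) * t := by
          have := mul_pos hx h0
          rw [abs_le]
          constructor <;> nlinarith
        have h3 : t ^ (s - 1) ≤ t := by
          simpa using Real.rpow_le_rpow_of_exponent_le ht.le (show s - 1 ≤ 1 by linarith)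
        rw [abs_mul, abs_of_nonneg (by positivity), Real.mul_rpow h0.le h1.le]
        calc t ^ (s - 1) * (t - 1) ^ (s - 1) * |x * t - s|
            ≤ t * (t - 1) ^ (s - 1) * ((x + 2) * t) := by gcongr
          _ = _ := by ring
  have hG : IntegrableOn (fun t : ℝ => t ^ s * (t - 1) ^ (s - 1) * Real.exp (-x * t)) (Ioi 1) :=
    integrableOn_of_abs_le_pow_mul_sub_one_rpow_mul_exp hx 2 (p := s - 1) (C := 1) (by linarith)
      (by fun_prop) fun t ht => by
        have h0 : 0 < t := by linarith
        have h1 : 0 < t - 1 := by linarith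
        rw [abs_of_nonneg (by positivity), one_mul]
        gcongr
        exact hpow t ht
  have h := integral_Ioi_eq_neg_of_hasDerivAt (a := 1)
    (f := fun t => t ^ s * (t - 1) ^ (s - 1) * Real.exp (-x * t))
    (f' := fun t => (s - 1) * (t ^ s * (t - 1) ^ (s - 2) * Real.exp (-x * t)) -
      (t * (t - 1)) ^ (s - 1) * (x * t - s) * Real.exp (-x * t))
    (ContinuousAt.continuousWithinAt <|
      ((continuousAt_id.rpow_const (Or.inl one_ne_zero)).mul
        ((continuousAt_id.sub continuousAt_const).rpow_const (Or.inr (by linarith)))).mul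
        (by fun_prop))
    (fun t ht => by
      have h0 : 0 < t := zero_lt_one.trans ht
      have h1 : 0 < t - 1 := sub_pos.2 ht
      convert! (((hasDerivAt_id t).rpow_const (p := s) (Or.inl h0.ne')).mul
        (((hasDerivAt_id t).sub_const 1).rpow_const (p := s - 1) (Or.inl h1.ne'))).mul
        (hasDerivAt_exp_neg_mul x t) using 1
      have e1 : t ^ s = t ^ (s - 1) * t := by
        rw [← Real.rpow_add_one h0.ne', sub_add_cancel]
      simp only [Pi.mul_apply, id]
      rw [Real.mul_rpow h0.le h1.le, e1, show s - 1 - 1 = s - 2 by ring]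
      ring)
    ((hA.const_mul (s - 1)).sub hB) hG
  rw [integral_sub (hA.const_mul (s - 1)) hB, integral_const_mul] at h
  have h0 : (0 : ℝ) ^ (s - 1) = 0 := Real.zero_rpow (by linarith)
  simp only [sub_self, h0, mul_zero, zero_mul, neg_zero] at h
  linarith

theorem rpow_le_rpow_add_rpow_neg {u a b : ℝ} (hu : 0 < u) (h : |a| ≤ b) :
    u ^ a ≤ u ^ b + u ^ (-b) := by
  obtain ⟨h1, h2⟩ := abs_le.1 h
  rcases le_total 1 u with hu1 | hu1
  · exact (Real.rpow_le_rpow_of_exponent_le hu1 h2).trans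
      (le_add_of_nonneg_right (by positivity))
  · exact (Real.rpow_le_rpow_of_exponent_ge hu hu1 h1).trans
      (le_add_of_nonneg_left (by positivity))

theorem abs_log_le_rpow_add_rpow_neg {u ε : ℝ} (hu : 0 < u) (hε : 0 < ε) :
    |Real.log u| ≤ (u ^ ε + u ^ (-ε)) / ε := by
  have h1 := Real.log_le_rpow_div hu.le hε
  have h2 := Real.log_le_rpow_div (inv_pos.2 hu).le hε
  rw [Real.log_inv, Real.inv_rpow hu.le, ← Real.rpow_neg hu.le] at h2
  have h3 : 0 < u ^ ε / ε := by positivity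
  have h4 : 0 < u ^ (-ε) / ε := by positivity
  rw [add_div, abs_le]
  constructor <;> linarith

theorem mul_sub_one_rpow_le {t a : ℝ} (ht : 1 < t) (ha : |a| ≤ 1 / 2) :
    (t * (t - 1)) ^ a ≤ t + (t - 1) ^ (-(1 / 2) : ℝ) := by
  have h0 : 0 < t := by linarith
  have h1 : 0 < t - 1 := by linarith
  refine (rpow_le_rpow_add_rpow_neg (mul_pos h0 h1) ha).trans (add_le_add ?_ ?_)
  · rw [← Real.sqrt_eq_rpow]
    exact Real.sqrt_le_iff.2 ⟨h0.le, by nlinarith⟩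
  · exact Real.rpow_le_rpow_of_nonpos h1 (by nlinarith) (by norm_num)

theorem mul_sub_one_rpow_mul_abs_log_le {t a : ℝ} (ht : 1 < t) (ha : |a| ≤ 1 / 4) :
    (t * (t - 1)) ^ a * |Real.log (t * (t - 1))| ≤ 8 * (t + (t - 1) ^ (-(1 / 2) : ℝ)) := by
  have hu : 0 < t * (t - 1) := mul_pos (by linarith) (by linarith)
  obtain ⟨h1, h2⟩ := abs_le.1 ha
  have hp := mul_sub_one_rpow_le ht (a := a + 1 / 4) (abs_le.2 ⟨by linarith, by linarith⟩)
  have hm := mul_sub_one_rpow_le ht (a := a + -(1 / 4)) (abs_le.2 ⟨by linarith, by linarith⟩)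
  rw [Real.rpow_add hu] at hp hm
  have hl := mul_le_mul_of_nonneg_left
    (abs_log_le_rpow_add_rpow_neg hu (ε := 1 / 4) (by norm_num)) (Real.rpow_pos_of_pos hu a).le
  linarith

theorem hasDerivAt_integral_mul_sub_one_rpow (hx : 0 < x) :
    HasDerivAt
      (fun s : ℝ => ∫ t in Ioi (1 : ℝ),
        (t * (t - 1)) ^ (s - 1) * (x * t - s) * Real.exp (-x * t))
      (-∫ t in Ioi (1 : ℝ), Real.log (t - 1) * (1 - x * t) * Real.exp (-x * t)) 1 := by
  obtain ⟨hint, hder⟩ := hasDerivAt_integral_of_dominated_loc_of_deriv_le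
    (μ := volume.restrict (Ioi (1 : ℝ))) (x₀ := (1 : ℝ)) (s := Metric.ball 1 (1 / 4))
    (F := fun s t => (t * (t - 1)) ^ (s - 1) * (x * t - s) * Real.exp (-x * t))
    (F' := fun s t => ((t * (t - 1)) ^ (s - 1) * Real.log (t * (t - 1)) * (x * t - s) -
      (t * (t - 1)) ^ (s - 1)) * Real.exp (-x * t))
    (bound := fun t => 9 * (x + 2) * (t ^ 2 * (t - 1) ^ (0 : ℝ) * Real.exp (-x * t) +
      t ^ 1 * (t - 1) ^ (-(1 / 2) : ℝ) * Real.exp (-x * t)))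
    (Metric.ball_mem_nhds _ (by norm_num))
    (Eventually.of_forall fun s => by fun_prop)
    (integrableOn_of_abs_le_pow_mul_sub_one_rpow_mul_exp hx 1 (p := 0) (C := x + 1) (by norm_num)
      (by fun_prop) fun t ht => by
        rw [Real.rpow_zero, sub_self, Real.rpow_zero, abs_le]
        constructor <;> nlinarith [mul_pos hx (zero_lt_one.trans ht)])
    (by fun_prop)
    ((ae_restrict_iff' measurableSet_Ioi).2 <| Eventually.of_forall fun t ht s hs => by
      have ht1 : 1 < t := ht
      have h0 : 0 < t := by linarith
      have h1 : 0 < t - 1 := by linarith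
      have ha : |s - 1| ≤ 1 / 4 := by
        rw [Metric.mem_ball, Real.dist_eq] at hs
        exact hs.le
      have hxt := mul_pos hx h0
      have hlin : |x * t - s| ≤ (x + 2) * t := by
        obtain ⟨h2, h3⟩ := abs_le.1 ha
        rw [abs_le]
        constructor <;> nlinarith
      have hone : 1 ≤ (x + 2) * t := by nlinarith
      have hpow := mul_sub_one_rpow_le ht1 (ha.trans (by norm_num))
      have hlog := mul_sub_one_rpow_mul_abs_log_le ht1 ha
      set m := t + (t - 1) ^ (-(1 / 2) : ℝ) with hm
      have hm0 : 0 < m := by positivity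
      rw [Real.norm_eq_abs, abs_mul, Real.abs_exp]
      have hp0 : 0 < (t * (t - 1)) ^ (s - 1) := by positivity
      calc |(t * (t - 1)) ^ (s - 1) * Real.log (t * (t - 1)) * (x * t - s) -
            (t * (t - 1)) ^ (s - 1)| * Real.exp (-x * t)
          ≤ ((t * (t - 1)) ^ (s - 1) * |Real.log (t * (t - 1))| * |x * t - s| +
            (t * (t - 1)) ^ (s - 1) * 1) * Real.exp (-x * t) := by
            gcongr
            refine (abs_sub _ _).trans_eq ?_
            rw [abs_mul, abs_mul, abs_of_pos hp0, mul_one]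
        _ ≤ (8 * m * ((x + 2) * t) + m * ((x + 2) * t)) * Real.exp (-x * t) := by gcongr
        _ = _ := by
            rw [hm, Real.rpow_zero]
            ring)
    (((integrableOn_pow_mul_sub_one_rpow_mul_exp hx 2 (by norm_num)).add
      (integrableOn_pow_mul_sub_one_rpow_mul_exp hx 1 (by norm_num))).const_mul _)
    ((ae_restrict_iff' measurableSet_Ioi).2 <| Eventually.of_forall fun t ht s _ => by
      have hu : 0 < t * (t - 1) := mul_pos (zero_lt_one.trans ht) (sub_pos.2 ht)
      convert! ((((hasDerivAt_id s).sub_const 1).const_rpow hu).mul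
        ((hasDerivAt_id s).const_sub (x * t))).mul_const (Real.exp (-x * t)) using 1
      simp only [id]
      ring)
  convert! hder using 1
  have hadd := integral_add hint (integrableOn_deriv_mul_log_mul_exp hx)
  rw [integral_deriv_mul_log_mul_exp hx, add_zero] at hadd
  rw [← hadd, ← integral_neg]
  refine setIntegral_congr_fun measurableSet_Ioi fun t ht => ?_
  simp only [sub_self, Real.rpow_zero]
  rw [Real.log_mul (zero_lt_one.trans ht).ne' (sub_pos.2 ht).ne']
  ring

end

/-- For `x > 0`, the function `h(s) := (s−1)∫_1^∞ t^s(t−1)^{s−2}e^{−xt}dt` has one-sided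
derivative at `s = 1` equal to `−∫_1^∞ log(t−1)·(1−xt)·e^{−xt} dt`. -/
theorem whittakerW_regularized_derivative (x : ℝ) (hx : 0 < x) :
    Tendsto (fun s : ℝ =>
        ((s - 1) * (∫ t in Set.Ioi (1:ℝ), t ^ s * (t - 1) ^ (s - 2) * Real.exp (-x * t))
          - Real.exp (-x)) / (s - 1))
      (nhdsWithin 1 (Set.Ioi 1))
      (nhds (-∫ t in Set.Ioi (1:ℝ),
        Real.log (t - 1) * (1 - x * t) * Real.exp (-x * t))) := by
  refine ((hasDerivAt_iff_tendsto_slope.1 (hasDerivAt_integral_mul_sub_one_rpow hx)).mono_left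
    (nhdsWithin_mono _ fun s hs => ne_of_gt hs)).congr' ?_
  filter_upwards [Ioo_mem_nhdsGT (one_lt_two (α := ℝ))] with s hs
  rw [sub_one_mul_integral_rpow_mul_exp hx hs.1 hs.2, slope_def_field]
  simp only [sub_self, Real.rpow_zero, one_mul]
  rw [integral_mul_sub_one_mul_exp hx]
end

section
/- For every z ∈ ℂ with Re(z) > 0, ∫_1^∞ e^{−zt} t^{−1} dt = Σ_{n=1}^∞ (−1)^{n+1} z^n/(n!·n) − Log z − γ, where Log denotes the principal branch of the complex logarithm. (In the notation of generalized exponential integrals: E₁(z) = Ein(z) − Log z − γ.) -/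
open MeasureTheory Set

open Filter Topology

/-- The exponential integral `E₁(z) = ∫_1^∞ e^{−zt} t^{−1} dt`. -/
noncomputable def expIntegralOne (z : ℂ) : ℂ :=
  ∫ t in Set.Ioi (1 : ℝ), Complex.exp (-z * t) * (t : ℂ)⁻¹

/-- The entire exponential integral `Ein(z) = Σ_{n≥1} (−1)^{n+1} z^n/(n!·n)`. -/
noncomputable def entireExpIntegral (z : ℂ) : ℂ :=
  ∑' n : ℕ, (-1) ^ n * z ^ (n + 1) / (((n + 1).factorial : ℂ) * (n + 1))

lemma norm_exp_neg_mul_inv_le (z : ℂ) {t : ℝ} (ht : 1 < t) :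
    ‖Complex.exp (-z * t) * (t : ℂ)⁻¹‖ ≤ Real.exp (-z.re * t) := by
  have h : ‖(t : ℂ)⁻¹‖ ≤ 1 := by
    rw [norm_inv, Complex.norm_real, Real.norm_of_nonneg (by linarith)]
    exact inv_le_one_of_one_le₀ ht.le
  calc ‖Complex.exp (-z * t) * (t : ℂ)⁻¹‖ ≤ ‖Complex.exp (-z * t)‖ * 1 := by
        rw [norm_mul]; gcongr
    _ = Real.exp (-z.re * t) := by simp [Complex.norm_exp]

lemma hasDerivAt_expIntegralOne {z : ℂ} (hz : 0 < z.re) :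
    HasDerivAt expIntegralOne (-Complex.exp (-z) / z) z := by
  have hmeas (w : ℂ) : AEStronglyMeasurable (fun t : ℝ ↦ Complex.exp (-w * t) * (t : ℂ)⁻¹)
      (volume.restrict (Ioi 1)) := by
    apply Measurable.aestronglyMeasurable
    fun_prop
  have hint : IntegrableOn (fun t : ℝ ↦ Real.exp (-(z.re / 2) * t)) (Ioi 1) :=
    integrableOn_exp_mul_Ioi (by linarith) 1
  have hs : {w : ℂ | z.re / 2 < w.re} ∈ 𝓝 z :=
    (isOpen_lt continuous_const Complex.continuous_re).mem_nhds (by simp; linarith)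
  have key := hasDerivAt_integral_of_dominated_loc_of_deriv_le
    (μ := volume.restrict (Ioi (1 : ℝ))) (x₀ := z)
    (F := fun w t ↦ Complex.exp (-w * t) * (t : ℂ)⁻¹)
    (F' := fun w t ↦ -Complex.exp (-w * t)) (bound := fun t ↦ Real.exp (-(z.re / 2) * t))
    hs (.of_forall hmeas) ?_ ?_ ?_ hint ?_
  · refine key.2.congr_deriv ?_
    rw [integral_neg, integral_exp_mul_complex_Ioi (by simpa using hz)]
    simp [neg_div, div_neg]
  · refine (integrableOn_exp_mul_Ioi (neg_lt_zero.2 hz) 1).mono' (hmeas z) ?_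
    filter_upwards [ae_restrict_mem measurableSet_Ioi] with t ht
    exact norm_exp_neg_mul_inv_le z ht
  · apply Continuous.aestronglyMeasurable
    fun_prop
  · filter_upwards [ae_restrict_mem measurableSet_Ioi] with t ht w hw
    simp only [norm_neg, Complex.norm_exp]
    have ht : 1 < t := ht
    have hw : z.re / 2 < w.re := hw
    simp
    nlinarith
  · filter_upwards [ae_restrict_mem measurableSet_Ioi] with t ht w hw
    have ht0 : (t : ℂ) ≠ 0 := by
      have : (1 : ℝ) < t := ht
      exact_mod_cast (by linarith : t ≠ 0)
    have h : HasDerivAt (fun w : ℂ ↦ -w * t) (-1 * t) w :=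
      (hasDerivAt_id w).neg.mul_const _
    refine (h.cexp.mul_const (t : ℂ)⁻¹).congr_deriv ?_
    field_simp

lemma tsum_neg_one_pow_mul_pow_div_factorial_succ {z : ℂ} (hz : z ≠ 0) :
    ∑' n : ℕ, (-1) ^ n * z ^ n / ((n + 1).factorial : ℂ) = (1 - Complex.exp (-z)) / z := by
  have h := NormedSpace.expSeries_div_hasSum_exp (-z)
  rw [← Complex.exp_eq_exp_ℂ, ← hasSum_nat_add_iff' 1] at h
  have h' := h.mul_left (-z⁻¹)
  have e : (fun n : ℕ ↦ -z⁻¹ * ((-z) ^ (n + 1) / ((n + 1).factorial : ℂ)))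
      = fun n : ℕ ↦ (-1) ^ n * z ^ n / ((n + 1).factorial : ℂ) := by
    funext n
    rw [neg_pow, pow_succ, pow_succ z]
    field_simp
  rw [e] at h'
  rw [h'.tsum_eq]
  simp
  field_simp
  ring

lemma hasDerivAt_entireExpIntegral (z : ℂ) :
    HasDerivAt entireExpIntegral (∑' n : ℕ, (-1) ^ n * z ^ n / ((n + 1).factorial : ℂ)) z := by
  refine hasDerivAt_tsum_of_isPreconnected
    (u := fun n : ℕ ↦ (‖z‖ + 1) ^ n / (n.factorial : ℝ)) (t := Metric.ball 0 (‖z‖ + 1)) (y₀ := 0)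
    (g := fun (n : ℕ) (w : ℂ) ↦ (-1) ^ n * w ^ (n + 1) / (((n + 1).factorial : ℂ) * (n + 1)))
    (g' := fun (n : ℕ) (w : ℂ) ↦ (-1) ^ n * w ^ n / ((n + 1).factorial : ℂ))
    (Real.summable_pow_div_factorial _) Metric.isOpen_ball
    (convex_ball _ _).isPreconnected ?_ ?_ (by simp; positivity) (by simp) (by simp)
  · intro n w _
    refine (((hasDerivAt_pow (n + 1) w).const_mul ((-1) ^ n)).div_const _).congr_deriv ?_
    have h1 : (n + 1 : ℂ) ≠ 0 := by exact_mod_cast n.succ_ne_zero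
    have h2 : ((n + 1).factorial : ℂ) ≠ 0 := by exact_mod_cast (n + 1).factorial_ne_zero
    push_cast
    field_simp
  · intro n w hw
    rw [mem_ball_zero_iff] at hw
    simp only [norm_div, norm_mul, norm_pow, norm_neg, norm_one, one_pow, one_mul,
      Complex.norm_natCast]
    gcongr
    omega

lemma tendsto_expIntegralOne_atTop :
    Tendsto (fun x : ℝ ↦ expIntegralOne x) atTop (𝓝 0) := by
  refine squeeze_zero_norm' (a := fun x : ℝ ↦ x⁻¹) ?_ tendsto_inv_atTop_zero
  filter_upwards [eventually_gt_atTop 0] with x hx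
  have h : ‖expIntegralOne x‖ ≤ ∫ t in Ioi (1 : ℝ), Real.exp (-x * t) := by
    refine norm_integral_le_of_norm_le (integrableOn_exp_mul_Ioi (neg_lt_zero.2 hx) 1) ?_
    filter_upwards [ae_restrict_mem measurableSet_Ioi] with t ht
    simpa using norm_exp_neg_mul_inv_le x ht
  refine h.trans ?_
  rw [integral_exp_mul_Ioi (neg_lt_zero.2 hx), neg_div_neg_eq, div_eq_mul_inv]
  have : Real.exp (-x * 1) ≤ 1 := Real.exp_le_one_iff.2 (by linarith)
  have hx' := inv_pos.2 hx
  nlinarith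

lemma tendsto_one_sub_exp_neg_mul_log :
    Tendsto (fun x : ℝ ↦ (1 - Real.exp (-x)) * Real.log x) (𝓝[≥] 0) (𝓝 0) := by
  have h : Tendsto (fun x : ℝ ↦ ‖x * Real.log x‖) (𝓝[≥] 0) (𝓝 0) := by
    have := (Real.continuous_mul_log.norm.tendsto 0).mono_left (nhdsWithin_le_nhds (s := Ici 0))
    simpa using this
  refine squeeze_zero_norm' ?_ h
  filter_upwards [self_mem_nhdsWithin] with x hx
  have hx : 0 ≤ x := hx
  rw [norm_mul, norm_mul]
  gcongr
  have h1 := Real.one_sub_le_exp_neg x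
  have h2 : Real.exp (-x) ≤ 1 := Real.exp_le_one_iff.2 (by linarith)
  rw [Real.norm_of_nonneg hx, Real.norm_of_nonneg (by linarith)]
  linarith

lemma integrableOn_log_mul_exp_neg :
    IntegrableOn (fun t : ℝ ↦ (Real.log t : ℂ) * Real.exp (-t)) (Ioi 0) := by
  have h : MellinConvergent (fun t : ℝ ↦ Real.log t • (Real.exp (-t) : ℂ)) 1 := by
    refine (mellin_hasDerivAt_of_isBigO_rpow (E := ℂ) (a := 2) (b := 0) ?_ ?_ (by norm_num) ?_
      (by norm_num)).1
    · refine (Continuous.continuousOn ?_).locallyIntegrableOn measurableSet_Ioi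
      fun_prop
    · rw [← Asymptotics.isBigO_norm_left]
      simp_rw [Complex.norm_real, Asymptotics.isBigO_norm_left]
      simpa only [neg_one_mul] using (isLittleO_exp_neg_mul_rpow_atTop zero_lt_one _).isBigO
    · simp_rw [neg_zero, Real.rpow_zero]
      refine Asymptotics.isBigO_const_of_tendsto (y := (1 : ℂ)) ?_ one_ne_zero
      rw [(by simp : (1 : ℂ) = Real.exp (-0))]
      exact (Complex.continuous_ofReal.comp
        (Real.continuous_exp.comp continuous_neg)).continuousWithinAt
  simpa [MellinConvergent] using h

lemma integral_log_mul_exp_neg :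
    ∫ t in Ioi (0 : ℝ), (Real.log t : ℂ) * Real.exp (-t)
      = -(Real.eulerMascheroniConstant : ℂ) := by
  have h := Complex.hasDerivAt_GammaIntegral (s := 1) (by simp)
  have h' := Complex.hasDerivAt_Gamma_one.congr_of_eventuallyEq
    (f₁ := Complex.GammaIntegral) ?_
  · simpa using h.unique h'
  · filter_upwards [(isOpen_lt continuous_const Complex.continuous_re).mem_nhds
      (show (0 : ℝ) < (1 : ℂ).re by simp)] with s hs
    exact (Complex.Gamma_eq_integral hs).symm

lemma hasDerivAt_entireExpIntegral_sub_log {z : ℂ} (hz : 0 < z.re) :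
    HasDerivAt (fun w ↦ entireExpIntegral w - Complex.log w) (-Complex.exp (-z) / z) z := by
  have hz0 : z ≠ 0 := by rintro rfl; simp at hz
  refine ((hasDerivAt_entireExpIntegral z).sub
    (Complex.hasDerivAt_log (Or.inl hz))).congr_deriv ?_
  rw [tsum_neg_one_pow_mul_pow_div_factorial_succ hz0]
  field_simp
  ring

lemma exists_expIntegralOne_eq_add_const :
    ∃ c : ℂ, ∀ z : ℂ, 0 < z.re →
      expIntegralOne z = entireExpIntegral z - Complex.log z + c :=
  (isOpen_lt continuous_const Complex.continuous_re).exists_eq_add_of_deriv_eq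
    (s := {z : ℂ | 0 < z.re}) (convex_halfSpace_re_gt 0).isPreconnected
    (fun _ hz ↦ (hasDerivAt_expIntegralOne hz).differentiableAt.differentiableWithinAt)
    (fun _ hz ↦ (hasDerivAt_entireExpIntegral_sub_log hz).differentiableAt.differentiableWithinAt)
    (fun _ hz ↦ (hasDerivAt_expIntegralOne hz).deriv.trans
      (hasDerivAt_entireExpIntegral_sub_log hz).deriv.symm)

lemma eq_neg_eulerMascheroniConstant_of_expIntegralOne_eq {c : ℂ}
    (hc : ∀ z : ℂ, 0 < z.re → expIntegralOne z = entireExpIntegral z - Complex.log z + c) :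
    c = -(Real.eulerMascheroniConstant : ℂ) := by
  -- `A` is a primitive of `log u * exp (-u)`, equal to `-exp (-u) * log u - E₁ u` for `u > 0`.
  let A : ℝ → ℂ := fun u ↦
    (((1 - Real.exp (-u)) * Real.log u : ℝ) : ℂ) - entireExpIntegral u - c
  have hA0 : A 0 = -c := by simp [A, entireExpIntegral]
  have hAeq (u : ℝ) (hu : 0 < u) :
      A u = -((Real.exp (-u) * Real.log u : ℝ) : ℂ) - expIntegralOne u := by
    rw [hc u (by simpa using hu), ← Complex.ofReal_log hu.le]
    simp only [A]
    push_cast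
    ring
  have hcont : ContinuousWithinAt A (Ici 0) 0 := by
    have h1 : ContinuousWithinAt (fun u : ℝ ↦ (1 - Real.exp (-u)) * Real.log u) (Ici 0) 0 := by
      simpa [ContinuousWithinAt] using tendsto_one_sub_exp_neg_mul_log
    have h2 : ContinuousAt (fun u : ℝ ↦ entireExpIntegral u) 0 :=
      (hasDerivAt_entireExpIntegral ((0 : ℝ) : ℂ)).continuousAt.comp
        (f := fun u : ℝ ↦ (u : ℂ)) Complex.continuous_ofReal.continuousAt
    exact ((Complex.continuous_ofReal.continuousAt.comp_continuousWithinAt h1).sub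
      h2.continuousWithinAt).sub continuousWithinAt_const
  have hderiv (u : ℝ) (hu : u ∈ Ioi (0 : ℝ)) :
      HasDerivAt A ((Real.log u : ℂ) * Real.exp (-u)) u := by
    have hu : 0 < u := hu
    have hu0 : (u : ℂ) ≠ 0 := by exact_mod_cast hu.ne'
    have h1 := (((hasDerivAt_neg u).exp.const_sub 1).mul
      (Real.hasDerivAt_log hu.ne')).ofReal_comp
    have h2 := (hasDerivAt_entireExpIntegral (u : ℂ)).comp_ofReal
    rw [tsum_neg_one_pow_mul_pow_div_factorial_succ hu0] at h2
    refine ((h1.sub h2).sub_const c).congr_deriv ?_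
    push_cast
    field_simp
    ring
  have htop : Tendsto A atTop (𝓝 0) := by
    have h1 : Tendsto (fun u : ℝ ↦ Real.exp (-u) * Real.log u) atTop (𝓝 0) := by
      refine squeeze_zero_norm' (a := fun u : ℝ ↦ u ^ 1 * Real.exp (-u)) ?_
        (Real.tendsto_pow_mul_exp_neg_atTop_nhds_zero 1)
      filter_upwards [eventually_ge_atTop 1] with u hu
      rw [norm_mul, Real.norm_of_nonneg (Real.exp_pos _).le,
        Real.norm_of_nonneg (Real.log_nonneg hu), pow_one, mul_comm]
      gcongr
      linarith [Real.log_le_sub_one_of_pos (by linarith : 0 < u)]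
    have h2 := ((Complex.continuous_ofReal.tendsto 0).comp h1).neg.sub
      tendsto_expIntegralOne_atTop
    simp only [Complex.ofReal_zero, neg_zero, sub_zero] at h2
    refine h2.congr' ?_
    filter_upwards [eventually_gt_atTop 0] with u hu
    exact (hAeq u hu).symm
  have h := integral_Ioi_of_hasDerivAt_of_tendsto hcont hderiv integrableOn_log_mul_exp_neg htop
  rw [integral_log_mul_exp_neg, hA0] at h
  simpa using h.symm

/-- For `Re z > 0`: `E₁(z) = ∫_1^∞ e^{−zt} t^{−1} dt = Ein(z) − Log z − γ`, where
`Ein(z) = Σ_{n≥1} (−1)^{n+1} z^n/(n!·n)`, `Log` is the principal logarithm and `γ` is the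
Euler–Mascheroni constant. -/
theorem exponential_integral_one (z : ℂ) (hz : 0 < z.re) :
    (∫ t in Set.Ioi (1:ℝ), Complex.exp (-z * t) * (t : ℂ)⁻¹)
      = (∑' n : ℕ, (-1) ^ n * z ^ (n + 1) / (((n + 1).factorial : ℂ) * (n + 1)))
        - Complex.log z - (Real.eulerMascheroniConstant : ℂ) := by
  obtain ⟨c, hc⟩ := exists_expIntegralOne_eq_add_const
  have h := hc z hz
  rwa [eq_neg_eulerMascheroniConstant_of_expIntegralOne_eq hc, ← sub_eq_add_neg] at h
end
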